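/- arXiv:2205.13709 — 3 statements merged into one kernel-verified Lean document; each statement's English description precedes it below -/
import Mathlib

section
/- (Lower bound for Gaussian data under pure DP.) There exists a universal constant C > 0 with the following property. Let d ≥ 9, n ≥ 1, ε > 0, and λ₁ > λ₂ > 0, and set κ := λ₁/(λ₁−λ₂). For every (ε,0)-differentially private randomized estimator M mapping datasets in (ℝ^d)^n to the unit sphere S^{d−1}, there exists a unit vector v₁ ∈ ℝ^d such that, with Σ := (λ₁−λ₂)v₁v₁ᵀ + λ₂·I_d (whose first and second eigenvalues are λ₁ and λ₂ and whose top eigenvector is v₁), one has E_{S ∼ N(0,Σ)^{⊗n}} E_{v̂ ∼ M(S)}[ sin(v̂, v₁) ] ≥ C·min( κ·(√(d/n) + d/(εn))·√(λ₂/λ₁) , 1 ). -/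
open MeasureTheory ProbabilityTheory Real Matrix
open scoped ENNReal NNReal Classical

noncomputable section

/-- Euclidean vectors in `ℝ^d`. -/
abbrev Vec (d : ℕ) : Type := EuclideanSpace ℝ (Fin d)

/-- `d × d` real matrices. -/
abbrev Mat (d : ℕ) : Type := Matrix (Fin d) (Fin d) ℝ

instance matMeasurableSpace {d : ℕ} : MeasurableSpace (Mat d) := MeasurableSpace.pi

/-- The spectral (ℓ₂-operator) norm of a matrix. -/
noncomputable def specNorm {d : ℕ} (A : Mat d) : ℝ :=
  ‖Matrix.toEuclideanCLM (𝕜 := ℝ) A‖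

/-- Matrix-vector multiplication, as a map on Euclidean space. -/
noncomputable def mulVecE {d : ℕ} (A : Mat d) (u : Vec d) : Vec d :=
  Matrix.toEuclideanCLM (𝕜 := ℝ) A u

/-- Reinterpret a Euclidean vector as a plain function. -/
def toVec' {d : ℕ} (u : Vec d) : Fin d → ℝ := u

/-- Real inner product on `ℝ^d`. -/
noncomputable def iprod {d : ℕ} (u v : Vec d) : ℝ := @inner ℝ _ _ u v

/-- Outer product `u vᵀ`. -/
def outer {d : ℕ} (u v : Vec d) : Mat d :=
  Matrix.vecMulVec (toVec' u) (toVec' v)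

/-- Entrywise expectation of a random matrix. -/
noncomputable def matExp {Ω : Type*} [MeasurableSpace Ω] {d : ℕ} (μ : Measure Ω)
    (A : Ω → Mat d) : Mat d :=
  Matrix.of fun i j => ∫ ω, A ω i j ∂μ

/-- The matrix `H_u = lam1⁻² E[(A-Σ) u uᵀ (A-Σ)ᵀ]` of Assumption A.4. -/
noncomputable def Hmat {Ω : Type*} [MeasurableSpace Ω] {d : ℕ} (μ : Measure Ω)
    (A : Ω → Mat d) (Sm : Mat d) (lam1 : ℝ) (u : Vec d) : Mat d :=
  (lam1 ^ 2)⁻¹ • matExp μ fun ω => (A ω - Sm) * outer u u * (A ω - Sm)ᵀ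

/-- `sin²` of the angle between two (nonzero) vectors. -/
noncomputable def sinSq {d : ℕ} (u v : Vec d) : ℝ :=
  1 - iprod u (v) ^ 2 / (‖u‖ ^ 2 * ‖v‖ ^ 2)

/-- `sin` of the angle between two unit vectors. -/
noncomputable def sinU {d : ℕ} (u v : Vec d) : ℝ :=
  Real.sqrt (1 - iprod u (v) ^ 2)

/-- Standard Gaussian measure on `ℝ^d` (as Euclidean space). -/
noncomputable def stdGaussianE (d : ℕ) : Measure (Vec d) :=
  (Measure.pi fun _ : Fin d => gaussianReal 0 1).map (EuclideanSpace.equiv (Fin d) ℝ).symm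

/-- `P` is the centered Gaussian measure with covariance matrix `S`, characterized through its
one-dimensional projections (Cramér–Wold). -/
def IsGaussianMeasure {d : ℕ} (P : Measure (Vec d)) (S : Mat d) : Prop :=
  IsProbabilityMeasure P ∧
    ∀ u : Vec d, P.map (fun x => iprod u (x)) = gaussianReal 0 (iprod u (mulVecE S u)).toNNReal

/-- Two datasets are neighboring if they differ in at most one entry. -/
def Neighboring {n : ℕ} {X : Type*} (S S' : Fin n → X) : Prop :=
  ∃ i₀, ∀ i, i ≠ i₀ → S i = S' i

/-- `(ε,δ)`-differential privacy of a randomized estimator mapping `n` points of `ℝ^d`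
to the unit sphere. -/
def DiffPrivate {n d : ℕ} (M : Kernel (Fin n → Vec d) (Metric.sphere (0 : Vec d) 1))
    (ε δ : ℝ) : Prop :=
  ∀ S S' : Fin n → Vec d, Neighboring S S' →
    ∀ B : Set (Metric.sphere (0 : Vec d) 1), MeasurableSet B →
      M S B ≤ ENNReal.ofReal (Real.exp ε) * M S' B + ENNReal.ofReal δ

/-- Clipping to norm at most `β`. -/
noncomputable def clipV {d : ℕ} (β : ℝ) (x : Vec d) : Vec d :=
  haveI := Classical.propDecidable (x = 0)
  if x = 0 then 0 else (min 1 (β / ‖x‖)) • x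

/-- Covariance (second-moment) matrix of a measure on `ℝ^d`. -/
noncomputable def covMatrix {d : ℕ} (P : Measure (Vec d)) : Mat d :=
  Matrix.of fun i j => ∫ x, toVec' x i * toVec' x j ∂P

end

lemma lintegral_pi_succ {X : Type*} [MeasurableSpace X] (P : Measure X) [IsProbabilityMeasure P]
    (n : ℕ) (F : (Fin (n+1) → X) → ℝ≥0∞) (hF : Measurable F) :
    ∫⁻ S, F S ∂(Measure.pi fun _ : Fin (n+1) => P) =
      ∫⁻ x, ∫⁻ s, F (Fin.cons x s) ∂(Measure.pi fun _ : Fin n => P) ∂P := by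
  have h := (measurePreserving_piFinSuccAbove (fun _ : Fin (n+1) => P) 0).symm
  rw [← h.lintegral_comp hF, lintegral_prod]
  · simp [MeasurableEquiv.piFinSuccAbove, Fin.insertNthEquiv]
  · exact (hF.comp (MeasurableEquiv.measurable _)).aemeasurable

lemma measurable_cons' {X : Type*} [MeasurableSpace X] (n : ℕ) :
    Measurable (fun p : X × (Fin n → X) => (Fin.cons p.1 p.2 : Fin (n+1) → X)) := by
  refine measurable_pi_lambda _ fun i => ?_
  refine Fin.cases ?_ (fun k => ?_) i
  · simpa using measurable_fst
  · simp only [Fin.cons_succ]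
    exact (measurable_pi_apply k).comp measurable_snd

/-- Tensorization of the pure-DP single coordinate comparison. -/
lemma dp_tensor {X : Type*} [MeasurableSpace X] (P Q : Measure X) [IsProbabilityMeasure P]
    [IsProbabilityMeasure Q] (a r : ℝ≥0∞)
    (h1 : ∀ f : X → ℝ≥0∞, Measurable f → (∀ x y, f x ≤ a * f y) → ∫⁻ x, f x ∂P ≤ r * ∫⁻ x, f x ∂Q) :
    ∀ (n : ℕ) (F : (Fin n → X) → ℝ≥0∞), Measurable F →
      (∀ S S', Neighboring S S' → F S ≤ a * F S') →
      ∫⁻ S, F S ∂(Measure.pi fun _ : Fin n => P) ≤ r ^ n * ∫⁻ S, F S ∂(Measure.pi fun _ : Fin n => Q) := by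
  intro n
  induction n with
  | zero =>
    intro F hF _
    have hF0 : F = fun _ => F default := funext fun x => congrArg F (Subsingleton.elim _ _)
    rw [hF0]
    simp
  | succ n ih =>
    intro F hF hN
    have hc : Measurable (fun p : X × (Fin n → X) => F (Fin.cons p.1 p.2)) :=
      hF.comp (measurable_cons' (X := X) n)
    rw [lintegral_pi_succ P n F hF, lintegral_pi_succ Q n F hF]
    calc ∫⁻ x, ∫⁻ s, F (Fin.cons x s) ∂(Measure.pi fun _ : Fin n => P) ∂P
        ≤ ∫⁻ x, r ^ n * ∫⁻ s, F (Fin.cons x s) ∂(Measure.pi fun _ : Fin n => Q) ∂P := by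
          refine lintegral_mono fun x => ih (fun s => F (Fin.cons x s)) ?_ ?_
          · exact hc.comp measurable_prodMk_left
          · rintro S S' ⟨i, hi⟩
            refine hN _ _ ⟨i.succ, fun j hj => ?_⟩
            refine Fin.cases (by simp) (fun k hk => ?_) j hj
            simp only [Fin.cons_succ]
            exact hi k (fun h => hk (by rw [h]))
      _ ≤ r * ∫⁻ x, r ^ n * ∫⁻ s, F (Fin.cons x s) ∂(Measure.pi fun _ : Fin n => Q) ∂Q := by
          refine h1 _ ?_ ?_
          · exact (Measurable.lintegral_prod_right' hc).const_mul _
          · intro x y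
            rw [mul_left_comm]
            gcongr
            rw [← lintegral_const_mul]
            · refine lintegral_mono fun s => hN _ _ ⟨0, fun j hj => ?_⟩
              refine Fin.cases (fun h => absurd rfl h) (fun k _ => ?_) j hj
              simp
            · exact hc.comp measurable_prodMk_left
      _ = _ := by
          rw [lintegral_const_mul _ (Measurable.lintegral_prod_right' hc), ← mul_assoc, pow_succ']

/-- Tensorization of the chi-square comparison. -/
lemma chi_tensor {X : Type*} [MeasurableSpace X] (P Q : Measure X) [IsProbabilityMeasure P]
    [IsProbabilityMeasure Q] (K : ℝ≥0∞)
    (h1 : ∀ f : X → ℝ≥0∞, Measurable f → (∫⁻ x, f x ∂P) ^ 2 ≤ K * ∫⁻ x, f x ^ 2 ∂Q) :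
    ∀ (n : ℕ) (F : (Fin n → X) → ℝ≥0∞), Measurable F →
      (∫⁻ S, F S ∂(Measure.pi fun _ : Fin n => P)) ^ 2
        ≤ K ^ n * ∫⁻ S, F S ^ 2 ∂(Measure.pi fun _ : Fin n => Q) := by
  intro n
  induction n with
  | zero =>
    intro F hF
    have hF0 : F = fun _ => F default := funext fun x => congrArg F (Subsingleton.elim _ _)
    rw [hF0]
    simp
  | succ n ih =>
    intro F hF
    have hc : Measurable (fun p : X × (Fin n → X) => F (Fin.cons p.1 p.2)) :=
      hF.comp (measurable_cons' (X := X) n)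
    rw [lintegral_pi_succ P n F hF, lintegral_pi_succ Q n _ (hF.pow_const 2)]
    calc (∫⁻ x, ∫⁻ s, F (Fin.cons x s) ∂(Measure.pi fun _ : Fin n => P) ∂P) ^ 2
        ≤ K * ∫⁻ x, (∫⁻ s, F (Fin.cons x s) ∂(Measure.pi fun _ : Fin n => P)) ^ 2 ∂Q :=
          h1 _ (Measurable.lintegral_prod_right' hc)
      _ ≤ K * ∫⁻ x, K ^ n * ∫⁻ s, F (Fin.cons x s) ^ 2 ∂(Measure.pi fun _ : Fin n => Q) ∂Q := by
          gcongr with x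
          exact ih (fun s => F (Fin.cons x s)) (hc.comp measurable_prodMk_left)
      _ = _ := by
          rw [lintegral_const_mul _ (Measurable.lintegral_prod_right' (hc.pow_const 2)),
            ← mul_assoc, pow_succ']

/-- single coordinate pure-DP comparison -/
lemma dp_single {X : Type*} [MeasurableSpace X] (Q : Measure X) [IsProbabilityMeasure Q]
    (g : X → ℝ≥0∞) (hg : Measurable g) [IsProbabilityMeasure (Q.withDensity g)]
    (c t : ℝ≥0∞) (hc : c ≠ ∞) (ht : ∫⁻ x, (g x - 1) ∂Q ≤ t)
    (f : X → ℝ≥0∞) (hf : Measurable f) (hfb : ∀ x y, f x ≤ (1 + c) * f y) :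
    ∫⁻ x, f x ∂(Q.withDensity g) ≤ (1 + c * t) * ∫⁻ x, f x ∂Q := by
  obtain ⟨x0⟩ : Nonempty X := by
    by_contra h
    rw [not_nonempty_iff] at h
    have := measure_univ (μ := Q)
    rw [Set.eq_empty_of_isEmpty Set.univ] at this
    simp at this
  by_cases hT : f x0 = ∞
  · have : ∀ x, f x = ∞ := by
      intro x
      have := hfb x0 x
      rw [hT, top_le_iff, ENNReal.mul_eq_top] at this
      rcases this with h | h
      · exact h.2
      · exact absurd h.1 (by simp [hc])
    simp [this]
  set m0 := ⨅ x, f x with hm0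
  have hm : m0 ≠ ∞ := ne_top_of_le_ne_top hT (iInf_le _ x0)
  have hle : ∀ x, f x ≤ (1 + c) * m0 := by
    intro x
    rw [hm0, ENNReal.mul_iInf_of_ne (by simp) (by simp [hc])]
    exact le_iInf (hfb x)
  have hmle : ∀ x, m0 ≤ f x := fun x => iInf_le _ x
  have hd : ∀ x, f x - m0 ≤ c * m0 := by
    intro x
    rw [tsub_le_iff_right]
    refine (hle x).trans (le_of_eq (by ring))
  have e1 : ∀ μ : Measure X, IsProbabilityMeasure μ → ∫⁻ x, f x ∂μ = m0 + ∫⁻ x, (f x - m0) ∂μ := by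
    intro μ _
    calc _ = ∫⁻ x, (m0 + (f x - m0)) ∂μ := by
            refine lintegral_congr fun x => (add_tsub_cancel_of_le (hmle x)).symm
      _ = _ := by
            rw [lintegral_add_left measurable_const]; simp
  rw [e1 _ inferInstance, lintegral_withDensity_eq_lintegral_mul _ hg (hf.sub_const _)]
  calc m0 + ∫⁻ x, (g * fun x => f x - m0) x ∂Q
      ≤ m0 + ∫⁻ x, ((f x - m0) + c * m0 * (g x - 1)) ∂Q := by
        gcongr with x
        simp only [Pi.mul_apply]
        calc g x * (f x - m0) ≤ (1 + (g x - 1)) * (f x - m0) := by gcongr; exact le_add_tsub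
          _ = (f x - m0) + (f x - m0) * (g x - 1) := by ring
          _ ≤ _ := by gcongr; exact hd x
    _ = (m0 + ∫⁻ x, (f x - m0) ∂Q) + c * m0 * ∫⁻ x, (g x - 1) ∂Q := by
        rw [lintegral_add_left (hf.sub_const _), lintegral_const_mul _ (hg.sub_const _), add_assoc]
    _ ≤ ∫⁻ x, f x ∂Q + c * t * ∫⁻ x, f x ∂Q := by
        rw [← e1 Q inferInstance]
        have : m0 ≤ ∫⁻ x, f x ∂Q := by
          rw [e1 Q inferInstance]; exact le_self_add
        calc _ ≤ ∫⁻ x, f x ∂Q + c * (∫⁻ x, f x ∂Q) * t := by gcongr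
          _ = _ := by ring
    _ = _ := by ring

/-- trivial single coordinate comparison -/
lemma dp_single_trivial {X : Type*} [MeasurableSpace X] (P Q : Measure X) [IsProbabilityMeasure P]
    [IsProbabilityMeasure Q] (a : ℝ≥0∞) 
    (f : X → ℝ≥0∞) (hf : Measurable f) (hfb : ∀ x y, f x ≤ a * f y) :
    ∫⁻ x, f x ∂P ≤ a * ∫⁻ x, f x ∂Q := by
  have h2 : ∀ x, f x ≤ a * ∫⁻ y, f y ∂Q := by
    intro x
    rw [← lintegral_const_mul _ hf]
    calc f x = ∫⁻ _, f x ∂Q := by simp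
      _ ≤ _ := lintegral_mono fun y => hfb x y
  calc _ ≤ ∫⁻ x, a * ∫⁻ y, f y ∂Q ∂P := lintegral_mono h2
    _ = _ := by simp

lemma chi_single {X : Type*} [MeasurableSpace X] (Q : Measure X)
    (g : X → ℝ≥0∞) (hg : Measurable g) (K : ℝ≥0∞) (hK : ∫⁻ x, g x ^ 2 ∂Q ≤ K)
    (f : X → ℝ≥0∞) (hf : Measurable f) :
    (∫⁻ x, f x ∂(Q.withDensity g)) ^ 2 ≤ K * ∫⁻ x, f x ^ 2 ∂Q := by
  rw [lintegral_withDensity_eq_lintegral_mul _ hg hf]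
  have h := ENNReal.lintegral_mul_le_Lp_mul_Lq Q (p := 2) (q := 2) 
    (by constructor <;> norm_num) hg.aemeasurable hf.aemeasurable
  calc _ ≤ _ := pow_le_pow_left' h 2
    _ = (∫⁻ x, g x ^ 2 ∂Q) * ∫⁻ x, f x ^ 2 ∂Q := by
      rw [mul_pow, ← ENNReal.rpow_natCast, ← ENNReal.rpow_natCast, ← ENNReal.rpow_mul,
        ← ENNReal.rpow_mul]
      norm_num
    _ ≤ _ := by gcongr


/-- Centered Gaussian law described through its quadratic form. -/
def IsG {d : ℕ} (P : Measure (Vec d)) (q : Vec d → ℝ) : Prop :=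
  IsProbabilityMeasure P ∧ ∀ u : Vec d, P.map (fun x => iprod u x) = gaussianReal 0 (q u).toNNReal

lemma measurable_iprod {d : ℕ} (u : Vec d) : Measurable (fun x => iprod u x) := by
  unfold iprod; fun_prop

lemma IsG.unique {d : ℕ} {P Q : Measure (Vec d)} {q : Vec d → ℝ} (hP : IsG P q) (hQ : IsG Q q) :
    P = Q := by
  have := hP.1
  have := hQ.1
  refine Measure.ext_of_charFun (funext fun u => ?_)
  have key : ∀ R : Measure (Vec d), charFun R u = charFun (R.map (fun x => iprod u x)) 1 := by
    intro R
    rw [charFun_apply, charFun_apply, integral_map (measurable_iprod u).aemeasurable (by fun_prop)]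
    simp [iprod, real_inner_comm]
  rw [key, key, hP.2, hQ.2]

/-- The quadratic form of the spiked covariance. -/
noncomputable def qf {d : ℕ} (l1 l2 : ℝ) (v u : Vec d) : ℝ := (l1 - l2) * iprod v u ^ 2 + l2 * ‖u‖ ^ 2

lemma quad_eq {d : ℕ} (l1 l2 : ℝ) (v u : Vec d) :
    iprod u (mulVecE ((l1 - l2) • outer v v + l2 • (1 : Mat d)) u) = qf l1 l2 v u := by
  have h1 : mulVecE (outer v v) u = iprod v u • v := by
    ext i
    have e : (mulVecE (outer v v) u) i = ((outer v v) *ᵥ (fun j => u j)) i := rfl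
    rw [e]
    simp only [outer, toVec', Matrix.vecMulVec, Matrix.mulVec, dotProduct, Matrix.of_apply, iprod,
      PiLp.inner_apply, PiLp.smul_apply, smul_eq_mul, Finset.sum_mul, RCLike.inner_apply, conj_trivial]
    refine Finset.sum_congr rfl fun j _ => ?_
    ring
  have h2 : mulVecE ((l1 - l2) • outer v v + l2 • (1 : Mat d)) u
      = (l1 - l2) • (iprod v u • v) + l2 • u := by
    rw [← h1]
    simp [mulVecE]
  rw [h2]
  simp only [iprod, qf, inner_add_right, inner_smul_right, real_inner_self_eq_norm_sq]
  rw [real_inner_comm u v]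
  ring

lemma isG_of {d : ℕ} {l1 l2 : ℝ} {v : Vec d} {P : Measure (Vec d)}
    (h : IsGaussianMeasure P ((l1 - l2) • outer v v + l2 • (1 : Mat d))) : IsG P (qf l1 l2 v) := by
  refine ⟨h.1, fun u => ?_⟩
  rw [h.2 u, quad_eq]

/-- density of scalar centered Gaussians -/
lemma gauss_density (l1 l2 : ℝ) (h1 : 0 < l1) (h2 : 0 < l2) :
    gaussianReal 0 l1.toNNReal = (gaussianReal 0 l2.toNNReal).withDensity
      (fun x => ENNReal.ofReal (√(l2 / l1) * Real.exp ((l1 - l2) / (2 * l1 * l2) * x ^ 2))) := by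
  have n1 : l1.toNNReal ≠ 0 := by simpa using h1
  have n2 : l2.toNNReal ≠ 0 := by simpa using h2
  rw [gaussianReal_of_var_ne_zero _ n1, gaussianReal_of_var_ne_zero _ n2,
    ← withDensity_mul _ (measurable_gaussianPDF _ _) (by fun_prop)]
  congr 1
  ext x
  simp only [Pi.mul_apply, gaussianPDF]
  rw [← ENNReal.ofReal_mul (gaussianPDFReal_nonneg _ _ _)]
  congr 1
  simp only [gaussianPDFReal, Real.coe_toNNReal _ h1.le, Real.coe_toNNReal _ h2.le]
  have hpi := Real.pi_pos
  have e1 : √(2 * π * l1) = √(2 * π) * √l1 := Real.sqrt_mul (by positivity) _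
  have e2 : √(2 * π * l2) = √(2 * π) * √l2 := Real.sqrt_mul (by positivity) _
  have e3 : √(l2 / l1) = √l2 / √l1 := Real.sqrt_div h2.le _
  have e4 : Real.exp (-(x - 0) ^ 2 / (2 * l1)) = Real.exp (-(x - 0) ^ 2 / (2 * l2)) *
      Real.exp ((l1 - l2) / (2 * l1 * l2) * x ^ 2) := by
    rw [← Real.exp_add]
    congr 1
    field_simp
    ring
  have p1 : 0 < √l1 := Real.sqrt_pos.2 h1
  have p2 : 0 < √l2 := Real.sqrt_pos.2 h2
  have p3 : 0 < √(2 * π) := Real.sqrt_pos.2 (by positivity)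
  rw [e1, e2, e3, e4]
  field_simp

lemma gauss_exp_sq : ∫⁻ x, ENNReal.ofReal (Real.exp (x ^ 2 / 4)) ∂(gaussianReal 0 1) ≤ 2 := by
  have h := gauss_density 2 1 (by norm_num) (by norm_num)
  have h2 := congrArg (fun μ => μ Set.univ) h
  simp only [measure_univ, withDensity_apply _ MeasurableSet.univ, Measure.restrict_univ,
    Real.toNNReal_one] at h2
  have h3 : (1 : ℝ≥0∞) = ENNReal.ofReal (√(1/2)) *
      ∫⁻ x, ENNReal.ofReal (Real.exp (x ^ 2 / 4)) ∂(gaussianReal 0 1) := by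
    rw [h2, ← lintegral_const_mul _ (by fun_prop)]
    refine lintegral_congr fun x => ?_
    rw [← ENNReal.ofReal_mul (by positivity)]
    congr 3
    norm_num
    ring
  have h4 : (1/2 : ℝ) ≤ √(1/2) := by
    apply Real.le_sqrt_of_sq_le; norm_num
  set I := ∫⁻ x, ENNReal.ofReal (Real.exp (x ^ 2 / 4)) ∂(gaussianReal 0 1)
  have h5 : ENNReal.ofReal (1/2) * I ≤ 1 := by
    rw [h3]; gcongr
  calc I = 2 * (ENNReal.ofReal (1/2) * I) := by
        rw [← mul_assoc]
        have : (2 : ℝ≥0∞) * ENNReal.ofReal (1/2) = 1 := by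
          rw [← ENNReal.ofReal_ofNat, ← ENNReal.ofReal_mul (by norm_num)]; norm_num
        rw [this, one_mul]
    _ ≤ 2 * 1 := by gcongr
    _ = 2 := by norm_num

lemma IsG.exp_sq {d : ℕ} {P : Measure (Vec d)} {q : Vec d → ℝ} (hP : IsG P q) (u : Vec d)
    (V : ℝ) (hV : 0 < V) (hq : q u ≤ V) :
    ∫⁻ x, ENNReal.ofReal (Real.exp (iprod u x ^ 2 / (4 * V))) ∂P ≤ 2 := by
  have e : ∫⁻ x, ENNReal.ofReal (Real.exp (iprod u x ^ 2 / (4 * V))) ∂P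
      = ∫⁻ y, ENNReal.ofReal (Real.exp (y ^ 2 / (4 * V))) ∂(gaussianReal 0 (q u).toNNReal) := by
    rw [← hP.2 u, lintegral_map (by fun_prop) (measurable_iprod u)]
  have e2 : gaussianReal 0 (q u).toNNReal = (gaussianReal 0 1).map (√((q u).toNNReal : ℝ) * ·) := by
    rw [gaussianReal_map_const_mul]
    congr 1
    · simp
    · ext
      simp
  rw [e, e2, lintegral_map (by fun_prop) (by fun_prop)]
  refine le_trans (lintegral_mono fun x => ?_) gauss_exp_sq
  apply ENNReal.ofReal_le_ofReal
  apply Real.exp_le_exp.2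
  rw [mul_pow, Real.sq_sqrt (by positivity), div_le_div_iff₀ (by positivity) (by norm_num)]
  have : ((q u).toNNReal : ℝ) ≤ V := by
    rw [Real.coe_toNNReal']
    exact max_le hq hV.le
  nlinarith [mul_le_mul_of_nonneg_right this (sq_nonneg x)]


/-- isotropic / diagonal Gaussian base measures -/
noncomputable def diagG {d : ℕ} (σ : Fin d → ℝ) : Measure (Vec d) :=
  (Measure.pi fun i => gaussianReal 0 (σ i).toNNReal).map (WithLp.toLp 2)

lemma diagG_isG {d : ℕ} (σ : Fin d → ℝ) (hσ : ∀ i, 0 ≤ σ i) :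
    IsG (diagG σ) (fun u => ∑ i, σ i * u i ^ 2) := by
  have hp : IsProbabilityMeasure (diagG σ) := by
    unfold diagG
    exact Measure.isProbabilityMeasure_map (by fun_prop)
  refine ⟨hp, fun u => ?_⟩
  refine Measure.ext_of_charFun (funext fun t => ?_)
  have h0 : charFun ((diagG σ).map (fun x => iprod u x)) t = charFun (diagG σ) (t • u) := by
    rw [charFun_apply, charFun_apply, integral_map (measurable_iprod u).aemeasurable (by fun_prop)]
    simp [iprod, real_inner_comm, inner_smul_right]
  have hnn : 0 ≤ ∑ i, σ i * u i ^ 2 := Finset.sum_nonneg fun i _ => mul_nonneg (hσ i) (sq_nonneg _)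
  rw [h0, diagG, charFun_pi, charFun_gaussianReal]
  simp_rw [charFun_gaussianReal, ← Complex.exp_sum]
  congr 1
  rw [Real.coe_toNNReal _ hnn]
  simp_rw [Real.coe_toNNReal _ (hσ _)]
  push_cast
  simp only [mul_zero, zero_mul, zero_sub, PiLp.smul_apply, smul_eq_mul, Finset.sum_neg_distrib, Finset.sum_mul, Finset.sum_div]
  congr 1
  refine Finset.sum_congr rfl fun i _ => ?_
  push_cast
  ring

lemma pi_density {m : ℕ} (μ : Fin (m+1) → Measure ℝ) [∀ i, IsProbabilityMeasure (μ i)]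
    (ρ : ℝ → ℝ≥0∞) (hρ : Measurable ρ) (ν : Fin (m+1) → Measure ℝ) [∀ i, IsProbabilityMeasure (ν i)]
    (h0 : ν 0 = (μ 0).withDensity ρ) (hs : ∀ i : Fin m, ν i.succ = μ i.succ) :
    Measure.pi ν = (Measure.pi μ).withDensity (fun x => ρ (x 0)) := by
  symm
  refine (Measure.pi_eq fun s hsm => ?_).symm
  rw [withDensity_apply _ (MeasurableSet.univ_pi hsm), ← lintegral_indicator (MeasurableSet.univ_pi hsm)]
  set F : Fin (m+1) → ℝ → ℝ≥0∞ := fun i => Fin.cases ((s 0).indicator ρ) (fun k => (s k.succ).indicator 1) i with hF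
  have hFm : ∀ i, Measurable (F i) := by
    intro i
    refine Fin.cases ?_ (fun k => ?_) i
    · exact hρ.indicator (hsm 0)
    · exact measurable_one.indicator (hsm _)
  have e : ∀ x : Fin (m+1) → ℝ, (Set.univ.pi s).indicator (fun x => ρ (x 0)) x = ∏ i, F i (x i) := by
    intro x
    by_cases hx : x ∈ Set.univ.pi s
    · rw [Set.indicator_of_mem hx, Fin.prod_univ_succ]
      have hx' : ∀ i, x i ∈ s i := fun i => hx i (Set.mem_univ _)
      simp [hF, hx']
    · rw [Set.indicator_of_notMem hx]
      have : ∃ i, x i ∉ s i := by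
        by_contra hc
        push Not at hc
        exact hx fun i _ => hc i
      obtain ⟨i, hi⟩ := this
      symm
      refine Finset.prod_eq_zero (Finset.mem_univ i) ?_
      revert hi
      refine Fin.cases (fun hi => ?_) (fun k hi => ?_) i <;> simp [hF, hi]
  simp_rw [e]
  have hi : iIndepFun (fun i (x : Fin (m+1) → ℝ) => F i (x i)) (Measure.pi μ) :=
    iIndepFun_pi (fun i => (hFm i).aemeasurable)
  rw [lintegral_prod_eq_prod_lintegral_of_indepFun _ _ hi
    (fun i => (hFm i).comp (measurable_pi_apply i))]
  refine Finset.prod_congr rfl fun i _ => ?_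
  have e2 : ∫⁻ x, F i (x i) ∂(Measure.pi μ) = ∫⁻ y, F i y ∂(μ i) :=
    (measurePreserving_eval μ i).lintegral_comp (hFm i)
  rw [e2]
  refine Fin.cases ?_ (fun k => ?_) i
  · rw [h0, withDensity_apply _ (hsm 0), ← lintegral_indicator (hsm 0)]
    simp [hF]
  · rw [hs]
    simp [hF, lintegral_indicator_one (hsm _)]

lemma IsG.map_iso {d : ℕ} {P : Measure (Vec d)} {q : Vec d → ℝ} (hP : IsG P q) (R : Vec d ≃ₗᵢ[ℝ] Vec d) :
    IsG (P.map R) (fun u => q (R.symm u)) := by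
  have := hP.1
  refine ⟨Measure.isProbabilityMeasure_map (by fun_prop), fun u => ?_⟩
  rw [Measure.map_map (measurable_iprod u) (by fun_prop), ← hP.2]
  congr 1
  ext x
  simp only [Function.comp, iprod]
  rw [← R.inner_map_map (R.symm u) x]
  simp

/-- the spiked Gaussian, as a tilted isotropic Gaussian -/
noncomputable def Gv {d : ℕ} (l1 l2 : ℝ) (v : Vec d) : Measure (Vec d) :=
  (diagG (fun _ : Fin d => l2)).withDensity
    (fun x => ENNReal.ofReal (√(l2 / l1) * Real.exp ((l1 - l2) / (2 * l1 * l2) * iprod v x ^ 2)))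

lemma withDensity_map {α β : Type*} [MeasurableSpace α] [MeasurableSpace β] (μ : Measure α)
    (f : α → β) (hf : Measurable f) (g : β → ℝ≥0∞) (hg : Measurable g) :
    (μ.withDensity (g ∘ f)).map f = (μ.map f).withDensity g := by
  ext s hs
  rw [Measure.map_apply hf hs, withDensity_apply _ (hf hs), withDensity_apply _ hs,
    setLIntegral_map hs hg hf]
  rfl

lemma Gv_e0 {m : ℕ} (l1 l2 : ℝ) (h1 : 0 < l1) (h2 : 0 < l2) :
    IsG (Gv l1 l2 (EuclideanSpace.single (0 : Fin (m+1)) (1 : ℝ)))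
      (qf l1 l2 (EuclideanSpace.single (0 : Fin (m+1)) (1 : ℝ))) := by
  set σ : Fin (m+1) → ℝ := Fin.cons l1 (fun _ => l2) with hσ
  have hσ0 : ∀ i, 0 ≤ σ i := by
    intro i
    refine Fin.cases ?_ (fun k => ?_) i <;> simp [hσ, h1.le, h2.le]
  have e : Gv l1 l2 (EuclideanSpace.single (0 : Fin (m+1)) (1 : ℝ)) = diagG σ := by
    unfold Gv diagG
    rw [pi_density (fun _ : Fin (m+1) => gaussianReal 0 l2.toNNReal)
      (fun x => ENNReal.ofReal (√(l2 / l1) * Real.exp ((l1 - l2) / (2 * l1 * l2) * x ^ 2))) (by fun_prop)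
      (fun i => gaussianReal 0 (σ i).toNNReal) (by simpa [hσ] using gauss_density l1 l2 h1 h2) (by simp [hσ]),
      ← withDensity_map _ _ (by fun_prop)]
    · congr 2
      ext x
      simp [iprod, PiLp.inner_apply]
    · have := measurable_iprod (EuclideanSpace.single (0 : Fin (m+1)) (1 : ℝ))
      fun_prop
  rw [e]
  convert diagG_isG σ hσ0 using 1
  ext u
  rw [qf, EuclideanSpace.norm_sq_eq, Fin.sum_univ_succ, Fin.sum_univ_succ]
  simp [hσ, iprod, PiLp.inner_apply]
  rw [← Finset.mul_sum]
  ring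

lemma Gv_isG {m : ℕ} (l1 l2 : ℝ) (h1 : 0 < l1) (h2 : 0 < l2) (v : Vec (m+1)) (hv : ‖v‖ = 1) :
    IsG (Gv l1 l2 v) (qf l1 l2 v) := by
  set e0 : Vec (m+1) := EuclideanSpace.single (0 : Fin (m+1)) (1 : ℝ) with he0
  have hn : ‖e0‖ = 1 := by simp [he0]
  set R := (ℝ ∙ (e0 - v))ᗮ.reflection with hR
  have hRe : R e0 = v := Submodule.reflection_sub (by rw [hn, hv])
  have hRv : R.symm v = e0 := by rw [← hRe, R.symm_apply_apply]
  have hin : ∀ x, iprod v (R x) = iprod e0 x := by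
    intro x
    rw [← hRe]
    exact R.inner_map_map _ _
  have hG : IsG (diagG (fun _ : Fin (m+1) => l2)) (fun u => l2 * ‖u‖ ^ 2) := by
    convert diagG_isG (fun _ : Fin (m+1) => l2) (fun _ => h2.le) using 1
    ext u
    rw [EuclideanSpace.norm_sq_eq, Finset.mul_sum]
    simp
  have hinv : (diagG (fun _ : Fin (m+1) => l2)).map R = diagG (fun _ : Fin (m+1) => l2) := by
    refine IsG.unique (q := fun u => l2 * ‖u‖ ^ 2) ?_ hG
    simpa using hG.map_iso R
  have e : Gv l1 l2 v = (Gv l1 l2 e0).map R := by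
    have hm := measurable_iprod v
    rw [Gv, ← hinv, ← withDensity_map _ _ (by fun_prop) _ (by fun_prop), Gv]
    congr 2
    ext x
    simp [hin]
  rw [e]
  convert (Gv_e0 (m := m) l1 l2 h1 h2).map_iso R using 1
  ext u
  simp only [qf]
  rw [R.symm.norm_map, ← hin (R.symm u), R.apply_symm_apply]

lemma Gv_density {d : ℕ} (l1 l2 : ℝ) (h1 : 0 < l1) (h2 : 0 < l2) (v w : Vec d) :
    Gv l1 l2 v = (Gv l1 l2 w).withDensity (fun x => ENNReal.ofReal
      (Real.exp ((l1 - l2) / (2 * l1 * l2) * (iprod v x ^ 2 - iprod w x ^ 2)))) := by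
  have hm := measurable_iprod v
  have hm' := measurable_iprod w
  rw [Gv, Gv, ← withDensity_mul _ (by fun_prop) (by fun_prop)]
  congr 1
  ext x
  simp only [Pi.mul_apply]
  rw [← ENNReal.ofReal_mul (by positivity), mul_assoc (√(l2 / l1)), ← Real.exp_add]
  congr 3
  ring


lemma abs_exp_sub_one_le' (h : ℝ) : |Real.exp h - 1| ≤ |h| * Real.exp |h| := by
  rcases le_total 0 h with hh | hh
  · have h1 : 1 ≤ Real.exp h := Real.one_le_exp hh
    rw [abs_of_nonneg (by linarith), abs_of_nonneg hh]
    have h2 := Real.add_one_le_exp (-h)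
    have h3 : Real.exp h * Real.exp (-h) = 1 := by rw [← Real.exp_add]; simp
    nlinarith [Real.exp_pos h]
  · have h1 : Real.exp h ≤ 1 := Real.exp_le_one_iff.2 hh
    rw [abs_of_nonpos (by linarith), abs_of_nonpos hh]
    have h2 := Real.add_one_le_exp h
    have h3 : 1 ≤ Real.exp (-h) := Real.one_le_exp (by linarith)
    nlinarith

lemma pointwise_bd (h s A B : ℝ) (hA : 0 ≤ A) (hB : 0 ≤ B) (hs : 0 ≤ s) (hs1 : s ≤ 1/16)
    (hh : h ^ 2 ≤ s ^ 2 * (A * B)) :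
    |Real.exp h - 1| ≤ 8 * s * (Real.exp (A / 4) + Real.exp (B / 4)) ∧
    (Real.exp h - 1) ^ 2 ≤ 256 * s ^ 2 * (Real.exp (A / 4) + Real.exp (B / 4)) := by
  set Y := max A B with hY
  have hY0 : 0 ≤ Y := le_max_of_le_left hA
  have hAB : A * B ≤ Y ^ 2 := by
    rw [sq]; exact mul_le_mul (le_max_left _ _) (le_max_right _ _) hB hY0
  have habs : |h| ≤ s * Y := by
    refine abs_le_of_sq_le_sq ?_ (by positivity)
    rw [mul_pow]
    exact hh.trans (by gcongr)
  have hE : Real.exp (Y / 4) ≤ Real.exp (A / 4) + Real.exp (B / 4) := by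
    rcases max_choice A B with h | h
    · rw [hY, h]; linarith [Real.exp_pos (B/4)]
    · rw [hY, h]; linarith [Real.exp_pos (A/4)]
  have h1 : |Real.exp h - 1| ≤ s * Y * Real.exp (Y / 16) := by
    refine (abs_exp_sub_one_le' h).trans ?_
    have : |h| ≤ Y / 16 := habs.trans (by nlinarith)
    gcongr
  have hy16 : Y ≤ 16 * Real.exp (Y / 16) := by
    have := Real.add_one_le_exp (Y / 16); linarith
  have hy8 : Y ≤ 8 * Real.exp (Y / 8) := by
    have := Real.add_one_le_exp (Y / 8); linarith
  constructor
  · calc _ ≤ s * Y * Real.exp (Y / 16) := h1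
      _ ≤ s * (8 * Real.exp (Y / 8)) * Real.exp (Y / 8) := by gcongr; norm_num
      _ = 8 * s * Real.exp (Y / 4) := by
        rw [show Y / 4 = Y / 8 + Y / 8 by ring, Real.exp_add]; ring
      _ ≤ _ := by gcongr
  · rw [← sq_abs]
    calc _ ≤ (s * Y * Real.exp (Y / 16)) ^ 2 := by gcongr
      _ ≤ (s * (16 * Real.exp (Y / 16)) * Real.exp (Y / 16)) ^ 2 := by gcongr
      _ = 256 * s ^ 2 * Real.exp (Y / 4) := by
        rw [show Y / 4 = Y / 16 + Y / 16 + Y / 16 + Y / 16 by ring]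
        simp only [Real.exp_add]; ring
      _ ≤ _ := by gcongr

/-- Likelihood ratio of two spiked Gaussians. -/
noncomputable def lr {d : ℕ} (l1 l2 : ℝ) (v w : Vec d) (x : Vec d) : ℝ≥0∞ :=
  ENNReal.ofReal (Real.exp ((l1 - l2) / (2 * l1 * l2) * (iprod v x ^ 2 - iprod w x ^ 2)))

lemma measurable_lr {d : ℕ} (l1 l2 : ℝ) (v w : Vec d) : Measurable (lr l1 l2 v w) := by
  have hm := measurable_iprod v
  have hm' := measurable_iprod w
  unfold lr
  fun_prop

lemma qf_bound1 {d : ℕ} (l1 l2 : ℝ) (h2 : 0 < l2) (h12 : l2 < l1) (v w : Vec d) (hv : ‖v‖ = 1)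
    (hw : ‖w‖ = 1) (hα : ‖v - w‖ * ((l1 - l2) / √(l1 * l2)) ≤ 1) :
    qf l1 l2 w (v - w) ≤ 2 * l2 * ‖v - w‖ ^ 2 := by
  have h1 : 0 < l1 := h2.trans h12
  set δ := ‖v - w‖ with hδ
  have hδ0 : 0 ≤ δ := norm_nonneg _
  have hδ2 : δ ≤ 2 := by
    calc δ ≤ ‖v‖ + ‖w‖ := norm_sub_le _ _
      _ = 2 := by rw [hv, hw]; norm_num
  have hin : iprod w (v - w) = - δ ^ 2 / 2 := by
    have := norm_sub_sq_real v w
    rw [hv, hw, ← hδ] at this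
    simp only [iprod, inner_sub_right, real_inner_self_eq_norm_sq, hw]
    rw [real_inner_comm v w]
    linarith
  have hsq : δ ^ 2 * (l1 - l2) ^ 2 ≤ l1 * l2 := by
    have hp : 0 < l1 * l2 := by positivity
    have := pow_le_one₀ (n := 2) (by have := sub_pos.2 h12; positivity) hα
    rw [mul_pow, div_pow, Real.sq_sqrt hp.le, ← mul_div_assoc, div_le_one hp] at this
    exact this
  have hkey : (l1 - l2) * δ ^ 2 ≤ 4 * l2 := by
    rcases le_total l1 (2 * l2) with h | h
    · nlinarith [sq_nonneg δ, pow_le_pow_left₀ hδ0 hδ2 2]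
    · have hpos : 0 < l1 - l2 := by linarith
      have : (l1 - l2) * ((l1 - l2) * δ ^ 2) ≤ (l1 - l2) * (4 * l2) := by nlinarith
      exact le_of_mul_le_mul_left this hpos
  rw [qf, hin]
  rw [← hδ]
  nlinarith [sq_nonneg δ]

lemma qf_bound2 {d : ℕ} (l1 l2 : ℝ) (h2 : 0 < l2) (h12 : l2 < l1) (v w : Vec d) (hv : ‖v‖ = 1)
    (hw : ‖w‖ = 1) : qf l1 l2 w (v + w) ≤ 4 * l1 := by
  have hn : ‖v + w‖ ≤ 2 := by
    calc _ ≤ ‖v‖ + ‖w‖ := norm_add_le _ _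
      _ = 2 := by rw [hv, hw]; norm_num
  have hn2 : ‖v + w‖ ^ 2 ≤ 4 := by nlinarith [norm_nonneg (v + w)]
  have hi : iprod w (v + w) ^ 2 ≤ ‖v + w‖ ^ 2 := by
    have := abs_real_inner_le_norm w (v + w)
    rw [hw, one_mul] at this
    rw [iprod, ← sq_abs]
    gcongr
  rw [qf]
  nlinarith

lemma lr_bounds {m : ℕ} (l1 l2 : ℝ) (h2 : 0 < l2) (h12 : l2 < l1) (v w : Vec (m+1)) (hv : ‖v‖ = 1)
    (hw : ‖w‖ = 1) (hvw : v ≠ w) (α : ℝ) (hαd : ‖v - w‖ * ((l1 - l2) / √(l1 * l2)) = α)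
    (hα : α ≤ 1/32) :
    ∫⁻ x, (lr l1 l2 v w x - 1) ∂(Gv l1 l2 w) ≤ ENNReal.ofReal (64 * α) ∧
    ∫⁻ x, (lr l1 l2 v w x) ^ 2 ∂(Gv l1 l2 w) ≤ ENNReal.ofReal (1 + 4096 * α ^ 2) := by
  have h1 : 0 < l1 := h2.trans h12
  have hδ : 0 < ‖v - w‖ := norm_pos_iff.2 (sub_ne_zero.2 hvw)
  have h12' : 0 < l1 - l2 := sub_pos.2 h12
  have hα0 : 0 ≤ α := by rw [← hαd]; positivity
  have hQ := Gv_isG l1 l2 h1 h2 w hw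
  have hP := Gv_isG l1 l2 h1 h2 v hv
  have := hQ.1
  have := hP.1
  set Q := Gv l1 l2 w with hQd
  set V := 2 * l2 * ‖v - w‖ ^ 2 with hV
  set W := 4 * l1 with hW
  have hV0 : 0 < V := by positivity
  have hW0 : 0 < W := by positivity
  set b := (l1 - l2) / (2 * l1 * l2) with hb
  have eA := hQ.exp_sq (v - w) V hV0 (qf_bound1 l1 l2 h2 h12 v w hv hw (by rw [hαd]; linarith))
  have eB := hQ.exp_sq (v + w) W hW0 (qf_bound2 l1 l2 h2 h12 v w hv hw)
  set E : Vec (m+1) → ℝ := fun x => Real.exp (iprod (v - w) x ^ 2 / (4 * V)) +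
    Real.exp (iprod (v + w) x ^ 2 / (4 * W)) with hE
  have hmE1 := measurable_iprod (v - w)
  have hmE2 := measurable_iprod (v + w)
  have hmEm : Measurable (fun x => ENNReal.ofReal (E x)) := by
    simp only [hE]; fun_prop
  have hEint : ∫⁻ x, ENNReal.ofReal (E x) ∂Q ≤ 4 := by
    simp only [hE]
    have : ∀ x, ENNReal.ofReal (Real.exp (iprod (v - w) x ^ 2 / (4 * V)) +
        Real.exp (iprod (v + w) x ^ 2 / (4 * W))) = ENNReal.ofReal (Real.exp (iprod (v - w) x ^ 2 / (4 * V)))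
        + ENNReal.ofReal (Real.exp (iprod (v + w) x ^ 2 / (4 * W))) := fun x =>
      ENNReal.ofReal_add (Real.exp_pos _).le (Real.exp_pos _).le
    simp_rw [this]
    rw [lintegral_add_left (by fun_prop)]
    calc _ ≤ (2 : ℝ≥0∞) + 2 := by gcongr
      _ = 4 := by norm_num
  have hpt : ∀ x, |Real.exp (b * (iprod v x ^ 2 - iprod w x ^ 2)) - 1| ≤ 16 * α * E x ∧
      (Real.exp (b * (iprod v x ^ 2 - iprod w x ^ 2)) - 1) ^ 2 ≤ 1024 * α ^ 2 * E x := by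
    intro x
    have hb2 : b ^ 2 * (V * W) ≤ (2 * α) ^ 2 := by
      have : α ^ 2 = ‖v - w‖ ^ 2 * ((l1 - l2) ^ 2 / (l1 * l2)) := by
        rw [← hαd, mul_pow, div_pow, Real.sq_sqrt (by positivity)]
      rw [mul_pow, this, hb, hV, hW]
      have e : ((l1 - l2) / (2 * l1 * l2)) ^ 2 * (2 * l2 * ‖v - w‖ ^ 2 * (4 * l1)) =
        2 * (‖v - w‖ ^ 2 * ((l1 - l2) ^ 2 / (l1 * l2))) := by
        field_simp
        ring
      rw [e]
      have : 0 ≤ ‖v - w‖ ^ 2 * ((l1 - l2) ^ 2 / (l1 * l2)) := by positivity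
      linarith
    have hfac : iprod v x ^ 2 - iprod w x ^ 2 = iprod (v - w) x * iprod (v + w) x := by
      simp only [iprod, inner_sub_left, inner_add_left]; ring
    have := pointwise_bd (b * (iprod v x ^ 2 - iprod w x ^ 2)) (2 * α)
      (iprod (v - w) x ^ 2 / V) (iprod (v + w) x ^ 2 / W) (by positivity) (by positivity)
      (by positivity) (by linarith) ?_
    · have c1 : iprod (v - w) x ^ 2 / V / 4 = iprod (v - w) x ^ 2 / (4 * V) := by
        rw [div_div, mul_comm V]
      have c2 : iprod (v + w) x ^ 2 / W / 4 = iprod (v + w) x ^ 2 / (4 * W) := by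
        rw [div_div, mul_comm W]
      rw [c1, c2] at this
      refine ⟨this.1.trans (le_of_eq ?_), this.2.trans (le_of_eq ?_)⟩ <;> simp only [hE] <;> ring
    · rw [hfac]
      calc (b * (iprod (v - w) x * iprod (v + w) x)) ^ 2
          = (b ^ 2 * (V * W)) * (iprod (v - w) x ^ 2 / V * (iprod (v + w) x ^ 2 / W)) := by
            field_simp
        _ ≤ _ := by gcongr
  constructor
  · calc ∫⁻ x, (lr l1 l2 v w x - 1) ∂Q ≤ ∫⁻ x, ENNReal.ofReal (16 * α) * ENNReal.ofReal (E x) ∂Q := by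
          refine lintegral_mono fun x => ?_
          rw [lr, ← ENNReal.ofReal_one, ← ENNReal.ofReal_sub _ zero_le_one,
            ← ENNReal.ofReal_mul (by positivity)]
          exact ENNReal.ofReal_le_ofReal ((le_abs_self _).trans (hpt x).1)
      _ ≤ ENNReal.ofReal (16 * α) * 4 := by
          rw [lintegral_const_mul _ hmEm]; gcongr
      _ = _ := by
          rw [← ENNReal.ofReal_ofNat, ← ENNReal.ofReal_mul (by positivity)]; congr 1; ring
  · have hone : ∫⁻ x, lr l1 l2 v w x ∂Q = 1 := by
      have h := measure_univ (μ := Gv l1 l2 v)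
      rw [Gv_density l1 l2 h1 h2 v w, withDensity_apply _ MeasurableSet.univ,
        Measure.restrict_univ] at h
      exact h
    have hmlr := measurable_lr l1 l2 v w
    have hid : ∀ x, lr l1 l2 v w x ^ 2 + 1 = ENNReal.ofReal
        ((Real.exp (b * (iprod v x ^ 2 - iprod w x ^ 2)) - 1) ^ 2) + 2 * lr l1 l2 v w x := by
      intro x
      rw [lr, ← ENNReal.ofReal_pow (Real.exp_pos _).le, ← ENNReal.ofReal_one, 
        ← ENNReal.ofReal_add (by positivity) zero_le_one, ← ENNReal.ofReal_ofNat,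
        ← ENNReal.ofReal_mul (by norm_num), ← ENNReal.ofReal_add (by positivity) (by positivity)]
      congr 1
      ring
    have hInt := lintegral_congr (μ := Q) hid
    have hm1 := measurable_iprod v
    have hm2 := measurable_iprod w
    rw [lintegral_add_left (hmlr.pow_const 2), lintegral_add_left (by fun_prop),
      lintegral_const_mul _ hmlr, hone] at hInt
    simp only [lintegral_const, measure_univ, mul_one] at hInt
    have hle : ∫⁻ x, ENNReal.ofReal ((Real.exp (b * (iprod v x ^ 2 - iprod w x ^ 2)) - 1) ^ 2) ∂Q
        ≤ ENNReal.ofReal (4096 * α ^ 2) := by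
      calc _ ≤ ∫⁻ x, ENNReal.ofReal (1024 * α ^ 2) * ENNReal.ofReal (E x) ∂Q := by
            refine lintegral_mono fun x => ?_
            rw [← ENNReal.ofReal_mul (by positivity)]
            exact ENNReal.ofReal_le_ofReal (hpt x).2
        _ ≤ ENNReal.ofReal (1024 * α ^ 2) * 4 := by
            rw [lintegral_const_mul _ hmEm]; gcongr
        _ = _ := by
            rw [← ENNReal.ofReal_ofNat, ← ENNReal.ofReal_mul (by positivity)]; congr 1; ring
    have hfin : ∫⁻ x, lr l1 l2 v w x ^ 2 ∂Q + 1 ≤ ENNReal.ofReal (1 + 4096 * α ^ 2) + 1 := by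
      rw [hInt, ENNReal.ofReal_add zero_le_one (by positivity), ENNReal.ofReal_one]
      calc _ ≤ ENNReal.ofReal (4096 * α ^ 2) + 2 := by gcongr
        _ = _ := by rw [← one_add_one_eq_two]; ring
    exact (ENNReal.add_le_add_iff_right ENNReal.one_ne_top).1 hfin


/-- sign of a Boolean -/
def sg (b : Bool) : ℝ := if b then 1 else -1

lemma sg_sq (b : Bool) : sg b ^ 2 = 1 := by cases b <;> simp [sg]

/-- the hypercube family of unit vectors -/
noncomputable def vE {m : ℕ} (τ : ℝ) (e : Fin m → Bool) : Vec (m+1) :=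
  WithLp.toLp 2 (Fin.cons (√(1 - τ ^ 2)) (fun i => sg (e i) * (τ / √m)))

lemma vE_zero {m : ℕ} (τ : ℝ) (e : Fin m → Bool) : vE τ e 0 = √(1 - τ ^ 2) := rfl

lemma vE_succ {m : ℕ} (τ : ℝ) (e : Fin m → Bool) (i : Fin m) :
    vE τ e i.succ = sg (e i) * (τ / √m) := rfl

lemma vE_tail_sq {m : ℕ} (hm : 0 < m) (τ : ℝ) (e : Fin m → Bool) :
    ∑ i : Fin m, vE τ e i.succ ^ 2 = τ ^ 2 := by
  simp_rw [vE_succ, mul_pow, sg_sq, div_pow, Real.sq_sqrt (Nat.cast_nonneg m)]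
  have : (m : ℝ) ≠ 0 := by positivity
  simp
  field_simp

lemma vE_norm {m : ℕ} (hm : 0 < m) (τ : ℝ) (h1 : τ ^ 2 ≤ 1) (e : Fin m → Bool) : ‖vE τ e‖ = 1 := by
  have : ‖vE τ e‖ ^ 2 = 1 := by
    rw [EuclideanSpace.norm_sq_eq, Fin.sum_univ_succ]
    simp only [Real.norm_eq_abs, sq_abs]
    rw [vE_tail_sq hm, vE_zero, Real.sq_sqrt (by linarith)]
    ring
  nlinarith [norm_nonneg (vE τ e)]

/-- flipping one coordinate -/
def flipB {m : ℕ} (i : Fin m) (e : Fin m → Bool) : Fin m → Bool := Function.update e i (!(e i))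

lemma flipB_invol {m : ℕ} (i : Fin m) : Function.Involutive (flipB i) := by
  intro e
  simp [flipB]

lemma flip_dist {m : ℕ} (hm : 0 < m) (τ : ℝ) (h0 : 0 < τ) (e : Fin m → Bool) (i : Fin m) :
    ‖vE τ e - vE τ (flipB i e)‖ = 2 * τ / √m := by
  have hm' : (0:ℝ) < m := by exact_mod_cast hm
  have hs : 0 < √(m:ℝ) := Real.sqrt_pos.2 hm'
  have : ‖vE τ e - vE τ (flipB i e)‖ ^ 2 = (2 * τ / √m) ^ 2 := by
    rw [EuclideanSpace.norm_sq_eq, Fin.sum_univ_succ]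
    simp only [Real.norm_eq_abs, sq_abs, PiLp.sub_apply, vE_zero, vE_succ]
    rw [Finset.sum_eq_single i]
    · rw [flipB, Function.update_self]
      have : sg (!(e i)) = - sg (e i) := by cases e i <;> simp [sg]
      rw [this]
      have := sg_sq (e i)
      calc _ = (sg (e i)) ^ 2 * (2 * τ / √m) ^ 2 := by ring
        _ = _ := by rw [this]; ring
    · intro j _ hj
      rw [flipB, Function.update_of_ne hj]; ring
    · simp
  exact (pow_left_inj₀ (norm_nonneg _) (by positivity) two_ne_zero).1 this

lemma center_norm {m : ℕ} : ‖(EuclideanSpace.single (0 : Fin (m+1)) (1 : ℝ))‖ = 1 := by simp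

lemma center_dist {m : ℕ} (hm : 0 < m) (τ : ℝ) (h0 : 0 < τ) (h1 : τ ≤ 1) (e : Fin m → Bool) :
    ‖vE τ e - EuclideanSpace.single (0 : Fin (m+1)) (1 : ℝ)‖ ≤ 2 * τ := by
  have : ‖vE τ e - EuclideanSpace.single (0 : Fin (m+1)) (1 : ℝ)‖ ^ 2 ≤ (2 * τ) ^ 2 := by
    rw [EuclideanSpace.norm_sq_eq, Fin.sum_univ_succ]
    have e0 := vE_tail_sq hm τ e
    simp only [Real.norm_eq_abs, sq_abs, PiLp.sub_apply, vE_zero]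
    simp only [EuclideanSpace.single_apply, Fin.succ_ne_zero, if_true, if_false, sub_zero]
    rw [e0]
    have hq : 0 ≤ 1 - τ ^ 2 := by nlinarith
    have h2 := Real.sq_sqrt hq
    have h3 : 1 - τ ^ 2 ≤ √(1 - τ ^ 2) := by
      apply Real.le_sqrt_of_sq_le; nlinarith
    nlinarith
  exact abs_le_of_sq_le_sq' this (by positivity) |>.2

lemma center_ne {m : ℕ} (hm : 0 < m) (τ : ℝ) (h0 : 0 < τ) (e : Fin m → Bool) :
    vE τ e ≠ EuclideanSpace.single (0 : Fin (m+1)) (1 : ℝ) := by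
  intro h
  have e0 := vE_tail_sq hm τ e
  rw [h] at e0
  simp [EuclideanSpace.single_apply, Fin.succ_ne_zero] at e0
  have : 0 < τ ^ 2 := by positivity
  simp [← e0] at this

/-- decoded sign pattern -/
noncomputable def dec {m : ℕ} (u : Vec (m+1)) (i : Fin m) : Bool := decide (0 ≤ u 0 * u i.succ)

/-- Hamming distance of `e` to the decoded pattern -/
noncomputable def Hd {m : ℕ} (u : Vec (m+1)) (e : Fin m → Bool) : ℕ :=
  (Finset.univ.filter fun i => e i ≠ dec u i).card

set_option maxHeartbeats 1000000 in
lemma sin_lower {m : ℕ} (hm : 0 < m) (τ : ℝ) (h0 : 0 < τ) (h1 : τ ≤ 1/2) (e : Fin m → Bool)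
    (u : Vec (m+1)) (hu : ‖u‖ = 1) : τ / (4 * m) * Hd u e ≤ sinU u (vE τ e) := by
  have hm' : (0:ℝ) < m := by exact_mod_cast hm
  have hH : (Hd u e : ℝ) ≤ m := by
    have : Hd u e ≤ m := by
      unfold Hd
      exact (Finset.card_le_univ _).trans (by simp)
    exact_mod_cast this
  have hH0 : (0:ℝ) ≤ Hd u e := by positivity
  set a := u 0 with ha
  set c := √(1 - τ ^ 2) with hc
  have hc2 : c ^ 2 = 1 - τ ^ 2 := Real.sq_sqrt (by nlinarith)
  have hc0 : 0 ≤ c := Real.sqrt_nonneg _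
  have hV := vE_tail_sq hm τ e
  have hU : a ^ 2 + ∑ i : Fin m, u i.succ ^ 2 = 1 := by
    have : ‖u‖ ^ 2 = 1 := by rw [hu]; norm_num
    rw [EuclideanSpace.norm_sq_eq, Fin.sum_univ_succ] at this
    simpa only [Real.norm_eq_abs, sq_abs] using this
  set U := ∑ i : Fin m, u i.succ ^ 2 with hUd
  set D := ∑ i : Fin m, u i.succ * vE τ e i.succ with hD
  have hip : iprod u (vE τ e) = a * c + D := by
    simp only [iprod, PiLp.inner_apply, Fin.sum_univ_succ, RCLike.inner_apply, conj_trivial, vE_zero]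
    rw [hD, mul_comm a c]
    congr 1
    exact Finset.sum_congr rfl fun i _ => mul_comm _ _
  have hCS : D ^ 2 ≤ U * τ ^ 2 := by
    rw [← hV]
    exact Finset.sum_mul_sq_le_sq_mul_sq _ _ _
  set T := ∑ i : Fin m, (a * vE τ e i.succ - c * u i.succ) ^ 2 with hT
  have hTe : T = a ^ 2 * τ ^ 2 + c ^ 2 * U - 2 * (a * c) * D := by
    rw [hT, ← hV, hUd, hD, Finset.mul_sum, Finset.mul_sum, Finset.mul_sum, ← Finset.sum_add_distrib,
      ← Finset.sum_sub_distrib]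
    exact Finset.sum_congr rfl fun i _ => by ring
  have hsin : T ≤ 1 - iprod u (vE τ e) ^ 2 := by
    rw [hip, hTe]
    have : (1:ℝ) = (a ^ 2 + U) * (c ^ 2 + τ ^ 2) := by rw [hU, hc2]; ring
    nlinarith
  have hTl : τ ^ 2 / 16 * (Hd u e / m) ≤ T := by
    have hHm : (Hd u e : ℝ) / m ≤ 1 := by rw [div_le_one hm']; exact hH
    have hHm0 : 0 ≤ (Hd u e : ℝ) / m := by positivity
    rcases le_total (1/2) (a ^ 2) with h | h
    · have : a ^ 2 * (τ ^ 2 * (Hd u e / m)) ≤ T := by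
        have e1 : a ^ 2 * (τ ^ 2 * (Hd u e / m)) = ∑ i ∈ Finset.univ.filter (fun i => e i ≠ dec u i),
            a ^ 2 * (τ ^ 2 / m) := by
          rw [Finset.sum_const, Hd, nsmul_eq_mul]; ring
        rw [e1, hT]
        refine le_trans (Finset.sum_le_sum fun i hi => ?_)
          (Finset.sum_le_sum_of_subset_of_nonneg (Finset.filter_subset _ _)
            fun i _ _ => sq_nonneg _)
        rw [Finset.mem_filter] at hi
        have hmis := hi.2
        have hsg : vE τ e i.succ * (a * u i.succ) ≤ 0 := by
          rw [vE_succ]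
          have hp : 0 < τ / √(m:ℝ) := div_pos h0 (Real.sqrt_pos.2 hm')
          cases hei : e i
          · rw [hei] at hmis
            have : 0 ≤ a * u i.succ := by
              by_contra hcon
              exact hmis (by simp [dec, ← ha, hcon])
            have h3 : 0 ≤ τ / √(m:ℝ) * (a * u i.succ) := by positivity
            simp only [sg]
            simp
            linarith
          · rw [hei] at hmis
            have : a * u i.succ ≤ 0 := by
              by_contra hcon
              push Not at hcon
              exact hmis (by simp [dec, ← ha, hcon.le])
            have h3 : τ / √(m:ℝ) * (a * u i.succ) ≤ 0 := mul_nonpos_of_nonneg_of_nonpos hp.le this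
            simp only [sg]
            simpa using h3
        have hv2 : vE τ e i.succ ^ 2 = τ ^ 2 / m := by
          rw [vE_succ, mul_pow, sg_sq, div_pow, Real.sq_sqrt hm'.le]; ring
        rw [← hv2]
        nlinarith [sq_nonneg (c * u i.succ), mul_nonneg hc0 (neg_nonneg.2 hsg)]
      have hp : 0 ≤ τ ^ 2 * (Hd u e / m) := by positivity
      nlinarith
    · have h2 : c ^ 2 * U / 2 - a ^ 2 * τ ^ 2 ≤ T := by
        rw [hT, ← hV, hUd, Finset.mul_sum, Finset.mul_sum, Finset.sum_div, ← Finset.sum_sub_distrib]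
        refine Finset.sum_le_sum fun i _ => ?_
        nlinarith [sq_nonneg (2 * a * vE τ e i.succ - c * u i.succ)]
      have hτ : τ ^ 2 ≤ 1/4 := by nlinarith
      have h3 : 1/16 ≤ c ^ 2 * U / 2 - a ^ 2 * τ ^ 2 := by
        have : U = 1 - a ^ 2 := by linarith
        rw [this, hc2]
        nlinarith [sq_nonneg a, sq_nonneg τ]
      have h4 : τ ^ 2 / 16 * (Hd u e / m) ≤ 1/16 := by
        have : τ ^ 2 / 16 * (Hd u e / m) ≤ τ ^ 2 / 16 * 1 := by gcongr
        linarith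
      linarith
  rw [sinU]
  apply Real.le_sqrt_of_sq_le
  refine le_trans ?_ hsin
  refine le_trans ?_ hTl
  have hHm : (Hd u e : ℝ) / m ≤ 1 := by rw [div_le_one hm']; exact hH
  have hHm0 : 0 ≤ (Hd u e : ℝ) / m := by positivity
  have hz : τ / (4 * m) * Hd u e = τ / 4 * (Hd u e / m) := by ring
  rw [hz]
  generalize (Hd u e : ℝ) / m = z at hHm hHm0
  have h5 : z * z ≤ z * 1 := mul_le_mul_of_nonneg_left hHm hHm0
  have h6 : 0 ≤ τ ^ 2 / 16 := by positivity
  have h7 := mul_le_mul_of_nonneg_left h5 h6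
  calc (τ / 4 * z) ^ 2 = τ ^ 2 / 16 * (z * z) := by ring
    _ ≤ _ := h7
    _ = _ := by ring

lemma hamming_count {m : ℕ} (u : Vec (m+1)) :
    (((Finset.univ.filter fun e : Fin m → Bool => 8 * Hd u e ≤ m).card : ℕ) : ℝ) ≤ (2 * (81/100)) ^ m := by
  set y : ℝ := (10/11) ^ 8 with hy
  have hsum : ∑ e : Fin m → Bool, y ^ Hd u e = (1 + y) ^ m := by
    have e1 : ∀ e : Fin m → Bool, y ^ Hd u e = ∏ i, (if e i ≠ dec u i then y else 1) := by
      intro e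
      rw [Finset.prod_ite]
      simp [Hd]
    simp_rw [e1]
    have := Finset.prod_univ_sum (fun _ : Fin m => (Finset.univ : Finset Bool))
      (fun i b => if b ≠ dec u i then y else (1:ℝ))
    rw [Fintype.piFinset_univ] at this
    rw [← this]
    have e2 : ∀ i : Fin m, ∑ b : Bool, (if b ≠ dec u i then y else (1:ℝ)) = 1 + y := by
      intro i
      cases dec u i <;> simp [add_comm]
    rw [Finset.prod_congr rfl (fun i _ => e2 i)]; simp
  have h1 : (((Finset.univ.filter fun e : Fin m → Bool => 8 * Hd u e ≤ m).card : ℕ) : ℝ)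
      ≤ ∑ e : Fin m → Bool, (11/10 : ℝ) ^ m * y ^ Hd u e := by
    rw [Finset.card_eq_sum_ones, Nat.cast_sum]
    refine le_trans (Finset.sum_le_sum fun e he => ?_)
      (Finset.sum_le_sum_of_subset_of_nonneg (Finset.filter_subset _ _) fun e _ _ => by positivity)
    rw [Finset.mem_filter] at he
    rw [hy, ← pow_mul]
    have : (11/10:ℝ) ^ (8 * Hd u e) ≤ (11/10) ^ m := pow_le_pow_right₀ (by norm_num) he.2
    calc ((1:ℕ):ℝ) = (11/10 * (10/11)) ^ (8 * Hd u e) := by norm_num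
      _ = (11/10) ^ (8 * Hd u e) * (10/11) ^ (8 * Hd u e) := by rw [mul_pow]
      _ ≤ _ := by gcongr
  refine h1.trans ?_
  rw [← Finset.mul_sum, hsum, ← mul_pow]
  refine pow_le_pow_left₀ (by positivity) ?_ m
  rw [hy]; norm_num


/-- the law of the output of the estimator -/
noncomputable def nu {n d : ℕ} (M : Kernel (Fin n → Vec d) (Metric.sphere (0 : Vec d) 1))
    (P : Measure (Vec d)) : Measure (Metric.sphere (0 : Vec d) 1) :=
  (Measure.pi fun _ : Fin n => P).bind M

lemma nu_lintegral {n d : ℕ} (M : Kernel (Fin n → Vec d) (Metric.sphere (0 : Vec d) 1))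
    (P : Measure (Vec d)) (f : Metric.sphere (0 : Vec d) 1 → ℝ≥0∞) (hf : Measurable f) :
    ∫⁻ u, f u ∂(nu M P) = ∫⁻ S, ∫⁻ u, f u ∂(M S) ∂(Measure.pi fun _ : Fin n => P) :=
  Measure.lintegral_bind M.aemeasurable hf.aemeasurable

lemma nu_apply {n d : ℕ} (M : Kernel (Fin n → Vec d) (Metric.sphere (0 : Vec d) 1))
    (P : Measure (Vec d)) (B : Set (Metric.sphere (0 : Vec d) 1)) (hB : MeasurableSet B) :
    nu M P B = ∫⁻ S, M S B ∂(Measure.pi fun _ : Fin n => P) :=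
  Measure.bind_apply hB M.aemeasurable

lemma nu_prob {n d : ℕ} (M : Kernel (Fin n → Vec d) (Metric.sphere (0 : Vec d) 1)) [IsMarkovKernel M]
    (P : Measure (Vec d)) [IsProbabilityMeasure P] : IsProbabilityMeasure (nu M P) := by
  constructor
  rw [nu_apply _ _ _ MeasurableSet.univ]
  simp

lemma measurable_dec {m : ℕ} (i : Fin m) :
    Measurable (fun u : Metric.sphere (0 : Vec (m+1)) 1 => dec (u : Vec (m+1)) i) := by
  refine measurable_to_bool ?_
  have : (fun u : Metric.sphere (0 : Vec (m+1)) 1 => dec (u : Vec (m+1)) i) ⁻¹' {true}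
      = {u : Metric.sphere (0 : Vec (m+1)) 1 | 0 ≤ (u : Vec (m+1)) 0 * (u : Vec (m+1)) i.succ} := by
    ext u; simp [dec]
  rw [this]
  exact measurableSet_le measurable_const (by fun_prop)

lemma measurableSet_dec {m : ℕ} (i : Fin m) (b : Bool) :
    MeasurableSet {u : Metric.sphere (0 : Vec (m+1)) 1 | b ≠ dec (u : Vec (m+1)) i} := by
  have := measurable_dec i (MeasurableSet.of_discrete (s := {c : Bool | b ≠ c}))
  exact this

lemma Hd_eq {m : ℕ} (u : Vec (m+1)) (e : Fin m → Bool) :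
    Hd u e = ∑ i, (if e i ≠ dec u i then 1 else 0) := by
  rw [Hd, Finset.card_filter]

lemma measurable_Hd {m : ℕ} (e : Fin m → Bool) :
    Measurable (fun u : Metric.sphere (0 : Vec (m+1)) 1 => Hd (u : Vec (m+1)) e) := by
  simp_rw [Hd_eq]
  refine Finset.measurable_sum _ fun i _ => ?_
  exact Measurable.ite (measurableSet_dec i (e i)) measurable_const measurable_const

lemma measurable_sinU {d : ℕ} (v : Vec d) :
    Measurable (fun u : Metric.sphere (0 : Vec d) 1 => ENNReal.ofReal (sinU (u : Vec d) v)) := by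
  unfold sinU iprod
  fun_prop

lemma Gv_dens' {m : ℕ} (l1 l2 : ℝ) (h2 : 0 < l2) (h12 : l2 < l1) (v w : Vec (m+1)) :
    Gv l1 l2 v = (Gv l1 l2 w).withDensity (lr l1 l2 v w) :=
  Gv_density l1 l2 (h2.trans h12) h2 v w

lemma nu_chi {n m : ℕ} (M : Kernel (Fin n → Vec (m+1)) (Metric.sphere (0 : Vec (m+1)) 1))
    [IsMarkovKernel M] (l1 l2 : ℝ) (h2 : 0 < l2) (h12 : l2 < l1) (v w : Vec (m+1)) (hv : ‖v‖ = 1)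
    (hw : ‖w‖ = 1) (hvw : v ≠ w) (α : ℝ) (hαd : ‖v - w‖ * ((l1 - l2) / √(l1 * l2)) = α)
    (hα : α ≤ 1/32) (hn : n * (4096 * α ^ 2) ≤ 1/2)
    (B : Set (Metric.sphere (0 : Vec (m+1)) 1)) (hB : MeasurableSet B) :
    (nu M (Gv l1 l2 v) B) ^ 2 ≤ 2 * nu M (Gv l1 l2 w) B := by
  have h1 : 0 < l1 := h2.trans h12
  have := (Gv_isG l1 l2 h1 h2 v hv).1
  have := (Gv_isG l1 l2 h1 h2 w hw).1
  have hb := (lr_bounds l1 l2 h2 h12 v w hv hw hvw α hαd hα).2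
  have hF : Measurable fun S => M S B := Kernel.measurable_coe M hB
  have key := chi_tensor (Gv l1 l2 v) (Gv l1 l2 w) (ENNReal.ofReal (1 + 4096 * α ^ 2))
    (fun f hf => by
      rw [Gv_dens' l1 l2 h2 h12 v w]
      exact chi_single _ _ (measurable_lr l1 l2 v w) _ hb f hf) n _ hF
  rw [nu_apply _ _ _ hB, nu_apply _ _ _ hB]
  refine key.trans ?_
  refine mul_le_mul' ?_ (lintegral_mono fun S => ?_)
  · rw [← ENNReal.ofReal_pow (by positivity), ← ENNReal.ofReal_ofNat]
    apply ENNReal.ofReal_le_ofReal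
    calc (1 + 4096 * α ^ 2) ^ n ≤ (Real.exp (4096 * α ^ 2)) ^ n := by
          gcongr
          linarith [Real.add_one_le_exp (4096 * α ^ 2)]
      _ = Real.exp (n * (4096 * α ^ 2)) := by rw [← Real.exp_nat_mul]
      _ ≤ Real.exp (1/2) := Real.exp_le_exp.2 hn
      _ ≤ 2 := by
        have h3 := Real.add_one_le_exp (-(1/2) : ℝ)
        rw [Real.exp_neg] at h3
        have h4 := Real.exp_pos (1/2)
        have h5 : (Real.exp (1/2)) * (Real.exp (1/2))⁻¹ = 1 := mul_inv_cancel₀ h4.ne'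
        nlinarith
  · have : M S B ≤ 1 := prob_le_one
    calc M S B ^ 2 = M S B * M S B := sq _
      _ ≤ M S B * 1 := by gcongr
      _ = _ := mul_one _

lemma nu_dp_trivial {n m : ℕ} (M : Kernel (Fin n → Vec (m+1)) (Metric.sphere (0 : Vec (m+1)) 1))
    [IsMarkovKernel M] (ε : ℝ) (hM : DiffPrivate M ε 0) (P Q : Measure (Vec (m+1)))
    [IsProbabilityMeasure P] [IsProbabilityMeasure Q]
    (B : Set (Metric.sphere (0 : Vec (m+1)) 1)) (hB : MeasurableSet B) :
    nu M P B ≤ ENNReal.ofReal (Real.exp (n * ε)) * nu M Q B := by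
  have hF : Measurable fun S => M S B := Kernel.measurable_coe M hB
  have key := dp_tensor P Q (ENNReal.ofReal (Real.exp ε)) (ENNReal.ofReal (Real.exp ε))
    (fun f hf hfb => dp_single_trivial P Q _ f hf hfb) n _ hF
    (fun S S' h => by simpa using hM S S' h B hB)
  rw [nu_apply _ _ _ hB, nu_apply _ _ _ hB]
  rwa [← ENNReal.ofReal_pow (by positivity), ← Real.exp_nat_mul] at key

lemma nu_dp {n m : ℕ} (M : Kernel (Fin n → Vec (m+1)) (Metric.sphere (0 : Vec (m+1)) 1))
    [IsMarkovKernel M] (ε : ℝ) (hε : 0 < ε) (hM : DiffPrivate M ε 0)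
    (l1 l2 : ℝ) (h2 : 0 < l2) (h12 : l2 < l1) (v w : Vec (m+1)) (hv : ‖v‖ = 1)
    (hw : ‖w‖ = 1) (hvw : v ≠ w) (α : ℝ) (hαd : ‖v - w‖ * ((l1 - l2) / √(l1 * l2)) = α)
    (hα : α ≤ 1/32)
    (B : Set (Metric.sphere (0 : Vec (m+1)) 1)) (hB : MeasurableSet B) :
    nu M (Gv l1 l2 v) B ≤
      ENNReal.ofReal (Real.exp (n * ((Real.exp ε - 1) * (64 * α)))) * nu M (Gv l1 l2 w) B := by
  have h1 : 0 < l1 := h2.trans h12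
  have iv := (Gv_isG l1 l2 h1 h2 v hv).1
  have := (Gv_isG l1 l2 h1 h2 w hw).1
  have hb := (lr_bounds l1 l2 h2 h12 v w hv hw hvw α hαd hα).1
  have hF : Measurable fun S => M S B := Kernel.measurable_coe M hB
  have h12' : 0 < l1 - l2 := sub_pos.2 h12
  have hα0 : 0 ≤ α := by rw [← hαd]; positivity
  have hc0 : 0 ≤ Real.exp ε - 1 := by linarith [Real.add_one_le_exp ε]
  have ha : 1 + ENNReal.ofReal (Real.exp ε - 1) = ENNReal.ofReal (Real.exp ε) := by
    rw [← ENNReal.ofReal_one, ← ENNReal.ofReal_add zero_le_one hc0]; congr 1; ring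
  have key := dp_tensor (Gv l1 l2 v) (Gv l1 l2 w) (1 + ENNReal.ofReal (Real.exp ε - 1))
    (1 + ENNReal.ofReal (Real.exp ε - 1) * ENNReal.ofReal (64 * α))
    (fun f hf hfb => by
      have hd := Gv_dens' l1 l2 h2 h12 v w
      have : IsProbabilityMeasure ((Gv l1 l2 w).withDensity (lr l1 l2 v w)) := hd ▸ iv
      rw [hd]
      exact dp_single _ _ (measurable_lr l1 l2 v w) _ _ ENNReal.ofReal_ne_top hb f hf hfb) n _ hF
    (fun S S' h => by rw [ha]; simpa using hM S S' h B hB)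
  rw [nu_apply _ _ _ hB, nu_apply _ _ _ hB]
  refine key.trans ?_
  gcongr
  rw [← ENNReal.ofReal_mul hc0, ← ENNReal.ofReal_one, ← ENNReal.ofReal_add zero_le_one (by positivity),
    ← ENNReal.ofReal_pow (by positivity), Real.exp_nat_mul]
  apply ENNReal.ofReal_le_ofReal
  gcongr
  linarith [Real.add_one_le_exp ((Real.exp ε - 1) * (64 * α))]

lemma assouad {m : ℕ} (hm : 0 < m) (τ : ℝ) (h0 : 0 < τ) (h1 : τ ≤ 1/2)
    (ν : (Fin m → Bool) → Measure (Metric.sphere (0 : Vec (m+1)) 1))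
    [∀ e, IsProbabilityMeasure (ν e)]
    (h : ∀ e i B, MeasurableSet B → (ν e B) ^ 2 ≤ 2 * ν (flipB i e) B) :
    ∃ e, ENNReal.ofReal (τ / 16) ≤
      ∫⁻ u, ENNReal.ofReal (sinU (u : Vec (m+1)) (vE τ e)) ∂(ν e) := by
  have hm' : (0:ℝ) < m := by exact_mod_cast hm
  set p : (Fin m → Bool) → Fin m → ℝ := fun e i =>
    (ν e).real {u | e i ≠ dec (u : Vec (m+1)) i} with hp
  have hpp : ∀ e i, 1/2 ≤ p e i + p (flipB i e) i := by
    intro e i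
    have hB := measurableSet_dec i (e i)
    have hset : {u : Metric.sphere (0 : Vec (m+1)) 1 | (flipB i e) i ≠ dec (u : Vec (m+1)) i}
        = {u : Metric.sphere (0 : Vec (m+1)) 1 | e i ≠ dec (u : Vec (m+1)) i}ᶜ := by
      ext u
      simp only [flipB, Function.update_self, Set.mem_ofPred_eq, Set.mem_compl_iff]
      cases e i <;> cases dec (u : Vec (m+1)) i <;> simp
    have h3 := h e i _ hB.compl
    have h4 : ((ν e).real {u | e i ≠ dec (u : Vec (m+1)) i}ᶜ) ^ 2
        ≤ 2 * (ν (flipB i e)).real {u | e i ≠ dec (u : Vec (m+1)) i}ᶜ := by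
      have := ENNReal.toReal_mono (by finiteness) h3
      simpa [Measure.real, ENNReal.toReal_pow, ENNReal.toReal_mul] using this
    rw [measureReal_compl hB, probReal_univ] at h4
    have e1 : p e i = (ν e).real {u | e i ≠ dec (u : Vec (m+1)) i} := rfl
    have e2 : p (flipB i e) i = (ν (flipB i e)).real {u | e i ≠ dec (u : Vec (m+1)) i}ᶜ := by
      rw [hp]; simp only; rw [hset]
    rw [← e1, ← e2] at h4
    nlinarith [sq_nonneg (p e i)]
  have hS : ∑ e : Fin m → Bool, (m:ℝ)/4 ≤ ∑ e, ∑ i, p e i := by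
    have hi : ∀ i, ∑ e : Fin m → Bool, (1/4:ℝ) ≤ ∑ e, p e i := by
      intro i
      have e1 : ∑ e, p (flipB i e) i = ∑ e, p e i :=
        Equiv.sum_comp (flipB_invol i).toPerm (fun e => p e i)
      have e2 : ∑ e : Fin m → Bool, (1/2:ℝ) ≤ ∑ e, (p e i + p (flipB i e) i) :=
        Finset.sum_le_sum fun e _ => hpp e i
      rw [Finset.sum_add_distrib, e1] at e2
      simp only [Finset.sum_const, nsmul_eq_mul] at e2 ⊢
      linarith
    rw [Finset.sum_comm]
    refine le_trans ?_ (Finset.sum_le_sum fun i _ => hi i)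
    simp only [Finset.sum_const, nsmul_eq_mul, Finset.card_univ, Fintype.card_fin]
    apply le_of_eq; ring
  obtain ⟨e, -, he⟩ := Finset.exists_le_of_sum_le Finset.univ_nonempty hS
  refine ⟨e, ?_⟩
  have e3 : ∫⁻ u, ENNReal.ofReal (τ / (4 * m)) * ∑ i : Fin m,
      Set.indicator {u : Metric.sphere (0 : Vec (m+1)) 1 | e i ≠ dec (u : Vec (m+1)) i} 1 u ∂(ν e)
      = ENNReal.ofReal (τ / (4 * m) * ∑ i, p e i) := by
    have hmi : ∀ i : Fin m, Measurable (Set.indicator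
        {u : Metric.sphere (0 : Vec (m+1)) 1 | e i ≠ dec (u : Vec (m+1)) i} (1 : Metric.sphere (0 : Vec (m+1)) 1 → ℝ≥0∞)) :=
      fun i => measurable_one.indicator (measurableSet_dec i (e i))
    rw [lintegral_const_mul _ (Finset.measurable_sum _ fun i _ => hmi i),
      lintegral_finsetSum _ (fun i _ => hmi i), ENNReal.ofReal_mul (by positivity),
      ENNReal.ofReal_sum_of_nonneg (fun i _ => measureReal_nonneg)]
    congr 1
    refine Finset.sum_congr rfl fun i _ => ?_
    rw [lintegral_indicator_one (measurableSet_dec i (e i))]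
    exact (ofReal_measureReal).symm
  calc ENNReal.ofReal (τ / 16) ≤ ENNReal.ofReal (τ / (4 * m) * ∑ i, p e i) := by
        apply ENNReal.ofReal_le_ofReal
        calc τ / 16 = τ / (4 * m) * (m / 4) := by field_simp; norm_num
          _ ≤ _ := by gcongr
    _ = _ := e3.symm
    _ ≤ _ := by
      refine lintegral_mono fun u => ?_
      have hu : ‖(u : Vec (m+1))‖ = 1 := by simp
      refine le_trans (le_of_eq ?_) (ENNReal.ofReal_le_ofReal (sin_lower hm τ h0 h1 e u hu))
      rw [ENNReal.ofReal_mul (by positivity), Hd_eq]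
      congr 1
      rw [ENNReal.ofReal_natCast, Nat.cast_sum]
      refine Finset.sum_congr rfl fun i _ => ?_
      simp only [Set.indicator, Set.mem_ofPred_eq, Pi.one_apply]
      split_ifs <;> simp

lemma packing {m : ℕ} (hm : 8 ≤ m) (τ : ℝ) (h0 : 0 < τ) (h1 : τ ≤ 1/2)
    (ν : (Fin m → Bool) → Measure (Metric.sphere (0 : Vec (m+1)) 1))
    [∀ e, IsProbabilityMeasure (ν e)] (ν0 : Measure (Metric.sphere (0 : Vec (m+1)) 1))
    [IsProbabilityMeasure ν0]
    (h : ∀ e B, MeasurableSet B → ν e B ≤ ENNReal.ofReal (Real.exp (m / 20)) * ν0 B) :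
    ∃ e, ENNReal.ofReal (τ / 64) ≤
      ∫⁻ u, ENNReal.ofReal (sinU (u : Vec (m+1)) (vE τ e)) ∂(ν e) := by
  have hm0 : 0 < m := by omega
  have hm' : (0:ℝ) < m := by exact_mod_cast hm0
  have hB : ∀ e : Fin m → Bool, MeasurableSet
      {u : Metric.sphere (0 : Vec (m+1)) 1 | 8 * Hd (u : Vec (m+1)) e ≤ m} := by
    intro e
    exact measurable_Hd e (MeasurableSet.of_discrete (s := {k : ℕ | 8 * k ≤ m}))
  have hcount : ∑ e : Fin m → Bool, ν0 {u | 8 * Hd (u : Vec (m+1)) e ≤ m}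
      ≤ ENNReal.ofReal ((2 * (81/100)) ^ m) := by
    have e1 : ∀ e : Fin m → Bool, ν0 {u | 8 * Hd (u : Vec (m+1)) e ≤ m} =
        ∫⁻ u, Set.indicator {u : Metric.sphere (0 : Vec (m+1)) 1 | 8 * Hd (u : Vec (m+1)) e ≤ m} 1 u ∂ν0 :=
      fun e => (lintegral_indicator_one (hB e)).symm
    simp_rw [e1]
    rw [← lintegral_finsetSum _ (fun e _ => measurable_one.indicator (hB e))]
    calc _ ≤ ∫⁻ u, ENNReal.ofReal ((2 * (81/100)) ^ m) ∂ν0 := by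
          refine lintegral_mono fun u => ?_
          refine le_trans (le_of_eq ?_) (ENNReal.ofReal_le_ofReal (hamming_count (u : Vec (m+1))))
          rw [ENNReal.ofReal_natCast, Finset.card_filter, Nat.cast_sum]
          refine Finset.sum_congr rfl fun e _ => ?_
          simp only [Set.indicator, Set.mem_ofPred_eq, Pi.one_apply]
          split_ifs <;> simp
      _ = _ := by simp
  have hsum : ∑ e : Fin m → Bool, ν e {u | 8 * Hd (u : Vec (m+1)) e ≤ m}
      ≤ ∑ e : Fin m → Bool, ENNReal.ofReal (1/2) := by
    calc _ ≤ ∑ e : Fin m → Bool, ENNReal.ofReal (Real.exp (m / 20)) *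
          ν0 {u | 8 * Hd (u : Vec (m+1)) e ≤ m} := Finset.sum_le_sum fun e _ => h e _ (hB e)
      _ ≤ ENNReal.ofReal (Real.exp (m / 20)) * ENNReal.ofReal ((2 * (81/100)) ^ m) := by
          rw [← Finset.mul_sum]; gcongr
      _ = ENNReal.ofReal (Real.exp (m / 20) * (2 * (81/100)) ^ m) := by
          rw [ENNReal.ofReal_mul (by positivity)]
      _ ≤ ENNReal.ofReal (2 ^ m * (1/2)) := by
          apply ENNReal.ofReal_le_ofReal
          have h3 : Real.exp (m / 20) = (Real.exp (1/20)) ^ m := by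
            rw [← Real.exp_nat_mul]; congr 1; ring
          have h4 : Real.exp (1/20) ≤ 20/19 := by
            have h3 := Real.add_one_le_exp (-(1/20) : ℝ)
            rw [Real.exp_neg] at h3
            have h4 := Real.exp_pos (1/20)
            have h5 : (Real.exp (1/20)) * (Real.exp (1/20))⁻¹ = 1 := mul_inv_cancel₀ h4.ne'
            nlinarith
          have h5 : (81/95 : ℝ) ^ m ≤ 1/2 :=
            (pow_le_pow_of_le_one (by norm_num) (by norm_num) hm).trans (by norm_num)
          calc Real.exp (m / 20) * (2 * (81/100)) ^ m
              ≤ (20/19) ^ m * (2 * (81/100)) ^ m := by rw [h3]; gcongr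
            _ = 2 ^ m * (81/95) ^ m := by rw [← mul_pow, ← mul_pow]; norm_num
            _ ≤ _ := by gcongr
      _ = _ := by
          rw [Finset.sum_const, ENNReal.ofReal_mul (by positivity), nsmul_eq_mul]
          congr 1
          simp [ENNReal.ofReal_pow]
  obtain ⟨e, he⟩ : ∃ e, ν e {u | 8 * Hd (u : Vec (m+1)) e ≤ m} ≤ ENNReal.ofReal (1/2) := by
    by_contra hcon
    push Not at hcon
    exact absurd hsum (not_le.2 (ENNReal.sum_lt_sum_of_nonempty Finset.univ_nonempty
      fun e _ => hcon e))
  refine ⟨e, ?_⟩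
  have hc : ENNReal.ofReal (1/2) ≤ ν e {u | 8 * Hd (u : Vec (m+1)) e ≤ m}ᶜ := by
    rw [prob_compl_eq_one_sub (hB e)]
    refine le_trans ?_ (tsub_le_tsub_left he 1)
    rw [← ENNReal.ofReal_one, ← ENNReal.ofReal_sub _ (by norm_num)]
    norm_num
  calc ENNReal.ofReal (τ / 64) = ENNReal.ofReal (τ / 32) * ENNReal.ofReal (1/2) := by
        rw [← ENNReal.ofReal_mul (by positivity)]; congr 1; ring
    _ ≤ ENNReal.ofReal (τ / 32) * ν e {u | 8 * Hd (u : Vec (m+1)) e ≤ m}ᶜ := by gcongr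
    _ = ∫⁻ u, Set.indicator {u : Metric.sphere (0 : Vec (m+1)) 1 | 8 * Hd (u : Vec (m+1)) e ≤ m}ᶜ
        (fun _ => ENNReal.ofReal (τ / 32)) u ∂(ν e) := (lintegral_indicator_const (hB e).compl _).symm
    _ ≤ _ := by
      refine lintegral_mono fun u => ?_
      rw [Set.indicator]
      split_ifs with hu
      · have hun : ‖(u : Vec (m+1))‖ = 1 := by simp
        refine ENNReal.ofReal_le_ofReal (le_trans ?_ (sin_lower hm0 τ h0 h1 e u hun))
        simp only [Set.mem_compl_iff, Set.mem_ofPred_eq, not_le] at hu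
        have hu' : (m:ℝ) / 8 ≤ Hd (u : Vec (m+1)) e := by
          have : (m:ℝ) < 8 * Hd (u : Vec (m+1)) e := by exact_mod_cast hu
          linarith
        calc τ / 32 = τ / (4 * m) * (m / 8) := by field_simp; norm_num
          _ ≤ _ := by gcongr
      · exact zero_le

lemma lower_np {n m : ℕ} (hn : 1 ≤ n) (hm : 0 < m)
    (M : Kernel (Fin n → Vec (m+1)) (Metric.sphere (0 : Vec (m+1)) 1))
    [IsMarkovKernel M] (l1 l2 : ℝ) (h2 : 0 < l2) (h12 : l2 < l1) (ρ : ℝ)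
    (hρ : ρ = (l1 - l2) / √(l1 * l2)) :
    ∃ v : Vec (m+1), ‖v‖ = 1 ∧ ENNReal.ofReal (min (1/2) (1/256 * √((m:ℝ) / n) / ρ) / 64) ≤
      ∫⁻ u, ENNReal.ofReal (sinU (u : Vec (m+1)) v) ∂(nu M (Gv l1 l2 v)) := by
  have h1 : 0 < l1 := h2.trans h12
  have h12' : 0 < l1 - l2 := sub_pos.2 h12
  have hρ0 : 0 < ρ := by rw [hρ]; positivity
  have hm' : (0:ℝ) < m := by exact_mod_cast hm
  have hn' : (1:ℝ) ≤ n := by exact_mod_cast hn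
  have hn0 : (0:ℝ) < n := by linarith
  set τ := min (1/2) (1/256 * √((m:ℝ) / n) / ρ) with hτ
  have hτ0 : 0 < τ := lt_min (by norm_num) (by positivity)
  have hτ1 : τ ≤ 1/2 := min_le_left _ _
  have hτ2 : τ ≤ 1/256 * √((m:ℝ) / n) / ρ := min_le_right _ _
  have hnorm : ∀ e : Fin m → Bool, ‖vE τ e‖ = 1 := fun e => vE_norm hm τ (by nlinarith) e
  have hprob : ∀ e : Fin m → Bool, IsProbabilityMeasure (Gv l1 l2 (vE τ e)) := fun e =>
    (Gv_isG l1 l2 h1 h2 _ (hnorm e)).1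
  have hnu : ∀ e : Fin m → Bool, IsProbabilityMeasure (nu M (Gv l1 l2 (vE τ e))) := fun e =>
    nu_prob M _
  have hα0 : 0 ≤ 2 * τ / √m * ρ := by positivity
  have hα1 : (2 * τ / √m * ρ) ^ 2 ≤ 1/16384 / n := by
    have h3 : τ * ρ ≤ 1/256 * √((m:ℝ) / n) := by rwa [le_div_iff₀ hρ0] at hτ2
    have h4 : (τ * ρ) ^ 2 ≤ (1/256 * √((m:ℝ) / n)) ^ 2 := pow_le_pow_left₀ (by positivity) h3 2
    rw [mul_pow _ (√((m:ℝ) / n)), Real.sq_sqrt (by positivity)] at h4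
    have h5 : (2 * τ / √m * ρ) ^ 2 = 4 * (τ * ρ) ^ 2 / m := by
      rw [mul_pow, div_pow, Real.sq_sqrt hm'.le]; ring
    rw [h5, div_le_iff₀ hm']
    calc 4 * (τ * ρ) ^ 2 ≤ 4 * ((1/256) ^ 2 * (m / n)) := by linarith
      _ = _ := by ring
  have hα2 : 2 * τ / √m * ρ ≤ 1/32 := by
    refine abs_le_of_sq_le_sq' ?_ (by norm_num) |>.2
    refine hα1.trans ?_
    rw [div_le_iff₀ hn0]; linarith
  have hα3 : n * (4096 * (2 * τ / √m * ρ) ^ 2) ≤ 1/2 := by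
    calc n * (4096 * (2 * τ / √m * ρ) ^ 2) ≤ n * (4096 * (1/16384 / n)) := by gcongr
      _ = 1/4 := by field_simp; norm_num
      _ ≤ _ := by norm_num
  obtain ⟨e, he⟩ := assouad hm τ hτ0 hτ1 (fun e => nu M (Gv l1 l2 (vE τ e))) (fun e i B hB => by
    have hd := flip_dist hm τ hτ0 e i
    refine nu_chi M l1 l2 h2 h12 _ _ (hnorm e) (hnorm _) ?_ (2 * τ / √m * ρ) ?_ hα2 hα3 B hB
    · intro hc
      rw [hc, sub_self, norm_zero] at hd
      have : 0 < 2 * τ / √m := by positivity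
      linarith
    · rw [hd, hρ])
  refine ⟨vE τ e, hnorm e, le_trans (ENNReal.ofReal_le_ofReal ?_) he⟩
  linarith

lemma lower_dp {n m : ℕ} (hn : 1 ≤ n) (hm : 8 ≤ m)
    (M : Kernel (Fin n → Vec (m+1)) (Metric.sphere (0 : Vec (m+1)) 1))
    [IsMarkovKernel M] (ε : ℝ) (hε : 0 < ε) (hM : DiffPrivate M ε 0)
    (l1 l2 : ℝ) (h2 : 0 < l2) (h12 : l2 < l1) (ρ : ℝ)
    (hρ : ρ = (l1 - l2) / √(l1 * l2)) (hεn : ε ^ 2 * n ≤ m + 1) :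
    ∃ v : Vec (m+1), ‖v‖ = 1 ∧
      ENNReal.ofReal (min (1/2) (Real.exp (-40) / 100000 * (((m:ℝ) + 1) / (ε * n)) / ρ) / 64) ≤
      ∫⁻ u, ENNReal.ofReal (sinU (u : Vec (m+1)) v) ∂(nu M (Gv l1 l2 v)) := by
  have h1 : 0 < l1 := h2.trans h12
  have h12' : 0 < l1 - l2 := sub_pos.2 h12
  have hρ0 : 0 < ρ := by rw [hρ]; positivity
  have hm0 : 0 < m := by omega
  have hm' : (8:ℝ) ≤ m := by exact_mod_cast hm
  have hn' : (1:ℝ) ≤ n := by exact_mod_cast hn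
  have hn0 : (0:ℝ) < n := by linarith
  have hwn : ‖(EuclideanSpace.single (0 : Fin (m+1)) (1 : ℝ))‖ = 1 := center_norm
  have hwp := (Gv_isG l1 l2 h1 h2 _ hwn).1
  have hw0 := nu_prob M (Gv l1 l2 (EuclideanSpace.single (0 : Fin (m+1)) (1 : ℝ)))
  by_cases hA : n * ε ≤ m / 20
  · have hnorm : ∀ e : Fin m → Bool, ‖vE (1/2) e‖ = 1 := fun e => vE_norm hm0 (1/2) (by norm_num) e
    have hprob : ∀ e : Fin m → Bool, IsProbabilityMeasure (Gv l1 l2 (vE (1/2) e)) := fun e =>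
      (Gv_isG l1 l2 h1 h2 _ (hnorm e)).1
    have hnu : ∀ e : Fin m → Bool, IsProbabilityMeasure (nu M (Gv l1 l2 (vE (1/2) e))) := fun e =>
      nu_prob M _
    obtain ⟨e, he⟩ := packing hm (1/2) (by norm_num) le_rfl (fun e => nu M (Gv l1 l2 (vE (1/2) e)))
      (nu M (Gv l1 l2 (EuclideanSpace.single (0 : Fin (m+1)) (1 : ℝ)))) (fun e B hB => by
        refine (nu_dp_trivial M ε hM _ (Gv l1 l2 (EuclideanSpace.single (0 : Fin (m+1)) (1 : ℝ)))
          B hB).trans ?_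
        gcongr)
    refine ⟨_, hnorm e, le_trans (ENNReal.ofReal_le_ofReal ?_) he⟩
    gcongr
    exact min_le_left _ _
  · push Not at hA
    have hε40 : ε ≤ 40 := by
      by_contra hc
      push Not at hc
      have : 40 * (n * ε) ≤ ε * (n * ε) := by
        have : 0 ≤ n * ε := by positivity
        nlinarith
      nlinarith
    have hexp : Real.exp ε - 1 ≤ ε * Real.exp 40 := by
      have h3 : Real.exp ε - 1 ≤ ε * Real.exp ε := by
        have h3 := Real.add_one_le_exp (-ε)
        have h4 := Real.exp_pos ε
        have h5 : Real.exp (-ε) * Real.exp ε = 1 := by rw [← Real.exp_add]; simp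
        nlinarith
      refine h3.trans ?_
      gcongr
    have hexp0 : 0 ≤ Real.exp ε - 1 := by linarith [Real.add_one_le_exp ε]
    set c := Real.exp (-40) / 100000 with hc
    have hc0 : 0 < c := by positivity
    have hc1 : c ≤ 1/100000 := by
      have : Real.exp (-40) ≤ 1 := Real.exp_le_one_iff.2 (by norm_num)
      rw [hc]; linarith
    have hcE : c * Real.exp 40 = 1/100000 := by
      have : Real.exp (-40) * Real.exp 40 = 1 := by rw [← Real.exp_add]; simp
      rw [hc]; linarith
    set τ := min (1/2) (c * (((m:ℝ) + 1) / (ε * n)) / ρ) with hτ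
    have hτ0 : 0 < τ := lt_min (by norm_num) (by positivity)
    have hτ1 : τ ≤ 1/2 := min_le_left _ _
    have hτ2 : τ ≤ c * (((m:ℝ) + 1) / (ε * n)) / ρ := min_le_right _ _
    have hεn0 : 0 < ε * n := by positivity
    have hτρ : τ * ρ * (ε * n) ≤ c * (m + 1) := by
      rw [le_div_iff₀ hρ0, ← mul_div_assoc, le_div_iff₀ hεn0] at hτ2
      exact hτ2
    have hτρ2 : 2 * (τ * ρ) ≤ 1/32 := by
      have h3 : 0 < τ * ρ := by positivity
      have h4 : τ * ρ * (m / 20) ≤ τ * ρ * (ε * n) := by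
        gcongr; linarith
      have h5 : c * (m + 1) ≤ 1/100000 * (2 * m) := by
        gcongr; linarith
      nlinarith
    have hnorm : ∀ e : Fin m → Bool, ‖vE τ e‖ = 1 := fun e => vE_norm hm0 τ (by nlinarith) e
    have hprob : ∀ e : Fin m → Bool, IsProbabilityMeasure (Gv l1 l2 (vE τ e)) := fun e =>
      (Gv_isG l1 l2 h1 h2 _ (hnorm e)).1
    have hnu : ∀ e : Fin m → Bool, IsProbabilityMeasure (nu M (Gv l1 l2 (vE τ e))) := fun e =>
      nu_prob M _
    obtain ⟨e, he⟩ := packing hm τ hτ0 hτ1 (fun e => nu M (Gv l1 l2 (vE τ e)))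
      (nu M (Gv l1 l2 (EuclideanSpace.single (0 : Fin (m+1)) (1 : ℝ)))) (fun e B hB => by
        have hd := center_dist hm0 τ hτ0 (by linarith) e
        set α := ‖vE τ e - EuclideanSpace.single (0 : Fin (m+1)) (1 : ℝ)‖ * ((l1 - l2) / √(l1 * l2)) with hα
        have hαle : α ≤ 2 * (τ * ρ) := by
          rw [hα, ← hρ]
          calc _ ≤ 2 * τ * ρ := by gcongr
            _ = _ := by ring
        refine (nu_dp M ε hε hM l1 l2 h2 h12 _ _ (hnorm e) hwn (center_ne hm0 τ hτ0 e) α hα.symm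
          (hαle.trans hτρ2) B hB).trans ?_
        gcongr
        calc n * ((Real.exp ε - 1) * (64 * α))
            ≤ n * ((ε * Real.exp 40) * (64 * (2 * (τ * ρ)))) := by gcongr
          _ = 128 * Real.exp 40 * (τ * ρ * (ε * n)) := by ring
          _ ≤ 128 * Real.exp 40 * (c * (m + 1)) := by gcongr
          _ = 128 * (c * Real.exp 40) * (m + 1) := by ring
          _ ≤ m / 20 := by rw [hcE]; linarith)
    exact ⟨_, hnorm e, he⟩


lemma rho_inv (l1 l2 : ℝ) (h2 : 0 < l2) (h12 : l2 < l1) (x : ℝ) :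
    l1 / (l1 - l2) * x * √(l2 / l1) = x / ((l1 - l2) / √(l1 * l2)) := by
  have h1 : 0 < l1 := h2.trans h12
  have h12' : 0 < l1 - l2 := sub_pos.2 h12
  have h3 : √(l1 * l2) = l1 * √(l2 / l1) := by
    have : l1 * l2 = l1 ^ 2 * (l2 / l1) := by field_simp
    rw [this, Real.sqrt_mul (by positivity), Real.sqrt_sq h1.le]
  rw [h3, div_div_eq_mul_div]
  ring


/-- Theorem 5.3: minimax lower bound for Gaussian data under pure DP. -/
theorem statement_4 :
    ∃ C : ℝ, 0 < C ∧
      ∀ (d n : ℕ) (ε lam1 lam2 : ℝ), 9 ≤ d → 1 ≤ n → 0 < ε → 0 < lam2 → lam2 < lam1 →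
        ∀ (M : Kernel (Fin n → Vec d) (Metric.sphere (0 : Vec d) 1)) [IsMarkovKernel M],
          DiffPrivate M ε 0 →
          ∃ v₁ : Vec d, ‖v₁‖ = 1 ∧
            ∀ P : Measure (Vec d),
              IsGaussianMeasure P ((lam1 - lam2) • outer v₁ v₁ + lam2 • (1 : Mat d)) →
              ENNReal.ofReal (C * min ((lam1 / (lam1 - lam2)) *
                  (Real.sqrt ((d : ℝ) / n) + (d : ℝ) / (ε * n)) * Real.sqrt (lam2 / lam1)) 1) ≤
                ∫⁻ S, (∫⁻ vh, ENNReal.ofReal (sinU (vh : Vec d) v₁) ∂(M S))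
                  ∂(Measure.pi fun _ : Fin n => P) := by
  refine ⟨Real.exp (-40) / 100000 / 128, by positivity, ?_⟩
  intro d n ε l1 l2 hd hn hε h2 h12 M _ hM
  obtain ⟨m, rfl⟩ : ∃ m, d = m + 1 := ⟨d - 1, by omega⟩
  have hm : 8 ≤ m := by omega
  have h1 : 0 < l1 := h2.trans h12
  have h12' : 0 < l1 - l2 := sub_pos.2 h12
  set ρ := (l1 - l2) / √(l1 * l2) with hρ
  have hρ0 : 0 < ρ := by rw [hρ]; positivity
  have hm' : (8:ℝ) ≤ m := by exact_mod_cast hm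
  have hn' : (1:ℝ) ≤ n := by exact_mod_cast hn
  have hn0 : (0:ℝ) < n := by linarith
  rw [rho_inv l1 l2 h2 h12, ← hρ]
  set c := Real.exp (-40) / 100000 with hc
  have hc0 : 0 < c := by positivity
  have hc1 : c ≤ 1/100000 := by
    have : Real.exp (-40) ≤ 1 := Real.exp_le_one_iff.2 (by norm_num)
    rw [hc]; linarith
  have reduce : ∀ x : ℝ, c / 128 * min ((√(((m+1 : ℕ) : ℝ) / n) + ((m+1 : ℕ) : ℝ) / (ε * n)) / ρ) 1 ≤ x →
      (∃ v : Vec (m+1), ‖v‖ = 1 ∧ ENNReal.ofReal x ≤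
        ∫⁻ u, ENNReal.ofReal (sinU (u : Vec (m+1)) v) ∂(nu M (Gv l1 l2 v))) →
      ∃ v₁ : Vec (m+1), ‖v₁‖ = 1 ∧
            ∀ P : Measure (Vec (m+1)),
              IsGaussianMeasure P ((l1 - l2) • outer v₁ v₁ + l2 • (1 : Mat (m+1))) →
              ENNReal.ofReal (c / 128 * min ((√(((m+1 : ℕ) : ℝ) / n) + ((m+1 : ℕ) : ℝ) / (ε * n)) / ρ) 1) ≤
                ∫⁻ S, (∫⁻ vh, ENNReal.ofReal (sinU (vh : Vec (m+1)) v₁) ∂(M S))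
                  ∂(Measure.pi fun _ : Fin n => P) := by
    rintro x hx ⟨v, hv, hle⟩
    refine ⟨v, hv, fun P hP => ?_⟩
    rw [IsG.unique (isG_of hP) (Gv_isG l1 l2 h1 h2 v hv), ← nu_lintegral M _ _ (measurable_sinU v)]
    exact (ENNReal.ofReal_le_ofReal hx).trans hle
  have hcast : ((m+1 : ℕ) : ℝ) = (m:ℝ) + 1 := by push_cast; ring
  rcases le_total (((m+1 : ℕ) : ℝ) / (ε * n)) (√(((m+1 : ℕ) : ℝ) / n)) with hcase | hcase
  · refine reduce _ ?_ (lower_np hn (by omega) M l1 l2 h2 h12 ρ hρ)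
    have hs : √(((m+1 : ℕ) : ℝ) / n) ≤ 2 * √((m:ℝ) / n) := by
      rw [Real.sqrt_le_left (by positivity), mul_pow, Real.sq_sqrt (by positivity), hcast,
        ← mul_div_assoc]
      gcongr
      linarith
    rw [le_div_iff₀ (by norm_num)]
    refine le_min ?_ ?_
    · have := min_le_right ((√(((m+1 : ℕ) : ℝ) / n) + ((m+1 : ℕ) : ℝ) / (ε * n)) / ρ) 1
      nlinarith
    · calc c / 128 * min ((√(((m+1 : ℕ) : ℝ) / n) + ((m+1 : ℕ) : ℝ) / (ε * n)) / ρ) 1 * 64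
          ≤ c / 128 * ((√(((m+1 : ℕ) : ℝ) / n) + ((m+1 : ℕ) : ℝ) / (ε * n)) / ρ) * 64 := by
            gcongr; exact min_le_left _ _
        _ ≤ c / 128 * ((4 * √((m:ℝ) / n)) / ρ) * 64 := by
            gcongr; linarith
        _ = (2 * c) * √((m:ℝ) / n) / ρ := by ring
        _ ≤ _ := by gcongr; linarith
  · have hεn : ε ^ 2 * n ≤ m + 1 := by
      rw [Real.sqrt_le_left (by positivity), div_pow, hcast, div_le_div_iff₀ hn0 (by positivity)] at hcase
      have h5 : 0 < ((m:ℝ) + 1) * n := by positivity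
      refine le_of_mul_le_mul_left ?_ h5
      linarith
    refine reduce _ ?_ (lower_dp hn hm M ε hε hM l1 l2 h2 h12 ρ hρ hεn)
    rw [le_div_iff₀ (by norm_num)]
    refine le_min ?_ ?_
    · have := min_le_right ((√(((m+1 : ℕ) : ℝ) / n) + ((m+1 : ℕ) : ℝ) / (ε * n)) / ρ) 1
      nlinarith
    · rw [← hc, ← hcast]
      calc c / 128 * min ((√(((m+1 : ℕ) : ℝ) / n) + ((m+1 : ℕ) : ℝ) / (ε * n)) / ρ) 1 * 64
          ≤ c / 128 * ((√(((m+1 : ℕ) : ℝ) / n) + ((m+1 : ℕ) : ℝ) / (ε * n)) / ρ) * 64 := by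
            gcongr; exact min_le_left _ _
        _ ≤ c / 128 * ((2 * (((m+1 : ℕ) : ℝ) / (ε * n))) / ρ) * 64 := by
            gcongr; linarith
        _ = _ := by ring
end

section
/- (Lower bound without the sub-Gaussian tail assumption, approximate DP.) There exists a universal constant C > 0 with the following property. Let d ≥ 2, n ≥ 1, 0 < ε ≤ d/4, and 0 < δ ≤ (1−e^{−ε})/(8e^{ε}). For every (ε,δ)-differentially private randomized estimator M mapping datasets in (ℝ^d)^n to the unit sphere S^{d−1}, there exist a unit vector v ∈ ℝ^d and α ∈ (0,1] such that the mixture distribution P := (1−α)·N(0, I_d) + α·( ½δ_{α^{−1/4}v} + ½δ_{−α^{−1/4}v} ) on ℝ^d satisfies: P has mean zero; its covariance is Σ_P = (1−α)I_d + √α·vvᵀ, with top eigenvector v, top eigenvalue λ₁ = 1−α+√α, second eigenvalue λ₂ = 1−α, and κ_P := λ₁/(λ₁−λ₂) = (1−α+√α)/√α; x ∼ P satisfies ‖E[(xxᵀ−Σ_P)(xxᵀ−Σ_P)ᵀ]‖₂ ≤ C·d and ‖E[(xxᵀ−Σ_P)uuᵀ(xxᵀ−Σ_P)ᵀ]‖₂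 ≤ C for every unit vector u; and E_{S ∼ P^{⊗n}} E_{v̂ ∼ M(S)}[ sin(v̂, v) ] ≥ (1/C)·κ_P·min( √( min(d, log((1−e^{−ε})/δ)) / (εn) ), 1 ). -/
open MeasureTheory ProbabilityTheory Real Matrix
open scoped ENNReal NNReal Classical

/-- Group privacy. -/
lemma group_priv {n d : ℕ} (M : Kernel (Fin n → Vec d) (Metric.sphere (0 : Vec d) 1))
    [IsMarkovKernel M] {ε δ : ℝ} (hε : 0 < ε) (hδ : 0 < δ) (hM : DiffPrivate M ε δ)
    (B : Set (Metric.sphere (0 : Vec d) 1)) (hB : MeasurableSet B) (k : ℕ) :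
    ∀ S S' : Fin n → Vec d, (Finset.univ.filter fun i => S i ≠ S' i).card ≤ k →
      (M S).real B ≤ Real.exp (k * ε) * (M S').real B
        + δ * ∑ j ∈ Finset.range k, Real.exp (j * ε) := by
  have h1 : ∀ S S' : Fin n → Vec d, Neighboring S S' →
      (M S).real B ≤ Real.exp ε * (M S').real B + δ := by
    intro S S' h
    have := hM S S' h B hB
    rw [← ofReal_measureReal, ← ofReal_measureReal (μ := M S'), ← ENNReal.ofReal_mul (by positivity),
      ← ENNReal.ofReal_add (by positivity) hδ.le] at this
    exact (ENNReal.ofReal_le_ofReal_iff (by positivity)).1 this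
  induction k with
  | zero =>
    intro S S' h
    have : S = S' := by
      funext i
      by_contra hne
      have : i ∈ (Finset.univ.filter fun i => S i ≠ S' i) := by simp [hne]
      have := Finset.card_pos.2 ⟨i, this⟩
      omega
    simp [this]
  | succ k ih =>
    intro S S' h
    by_cases hS : ∃ i, S i ≠ S' i
    · obtain ⟨i, hi⟩ := hS
      have hsub : (Finset.univ.filter fun j => Function.update S i (S' i) j ≠ S' j) ⊆
          (Finset.univ.filter fun i => S i ≠ S' i).erase i := by
        intro j hj
        simp only [Finset.mem_filter, Finset.mem_univ, true_and, Finset.mem_erase] at hj ⊢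
        by_cases hji : j = i
        · subst hji; simp at hj
        · refine ⟨hji, ?_⟩
          simpa [Function.update_of_ne hji] using hj
      have hc := Finset.card_le_card hsub
      rw [Finset.card_erase_of_mem (by simp [hi])] at hc
      have a := ih (Function.update S i (S' i)) S' (by omega)
      have b := h1 S (Function.update S i (S' i))
        ⟨i, fun j hj => (Function.update_of_ne hj _ _).symm⟩
      rw [Finset.sum_range_succ']
      have e : ∀ j : ℕ, Real.exp (((j + 1 : ℕ) : ℝ) * ε) = Real.exp ε * Real.exp (j * ε) := by
        intro j; rw [← Real.exp_add]; congr 1; push_cast; ring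
      simp_rw [e, ← Finset.mul_sum]
      have := mul_le_mul_of_nonneg_left a (Real.exp_pos ε).le
      simp only [Nat.cast_zero, zero_mul, Real.exp_zero]
      nlinarith
    · push Not at hS
      have : S = S' := funext hS
      rw [this]
      have h0 := measureReal_nonneg (μ := M S') (s := B)
      have h2 : 1 ≤ Real.exp (((k + 1 : ℕ) : ℝ) * ε) := Real.one_le_exp (by positivity)
      have h3 : 0 ≤ δ * ∑ j ∈ Finset.range (k + 1), Real.exp (j * ε) := by positivity
      nlinarith

lemma geom_bound {ε : ℝ} (q : ℕ) :
    (∑ j ∈ Finset.range (q + 1), Real.exp (j * ε)) * (1 - Real.exp (-ε)) ≤ Real.exp (q * ε) := by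
  have : (∑ j ∈ Finset.range (q + 1), Real.exp (j * ε)) * (1 - Real.exp (-ε))
      = Real.exp (q * ε) - Real.exp (-ε) := by
    induction q with
    | zero => simp
    | succ q ih =>
      rw [Finset.sum_range_succ, add_mul, ih]
      have : Real.exp ((q + 1 : ℕ) * ε) * Real.exp (-ε) = Real.exp (q * ε) := by
        rw [← Real.exp_add]; congr 1; push_cast; ring
      rw [mul_sub, this]; ring
  have := Real.exp_pos (-ε)
  linarith

lemma coupling {X : Type*} [MeasurableSpace X] [MeasurableEq X] {n : ℕ} (G D : Measure X)
    [IsProbabilityMeasure G] [IsProbabilityMeasure D] (α : ℝ) (h0 : 0 ≤ α) (h1 : α ≤ 1)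
    (f : (Fin n → X) → ℝ≥0∞) (hf : Measurable f) (hf1 : ∀ S, f S ≤ 1) (a b : ℝ≥0∞) (k : ℕ)
    (hab : ∀ S S' : Fin n → X, (Finset.univ.filter fun i => S i ≠ S' i).card ≤ k →
      f S ≤ a * f S' + b) :
    ∫⁻ S, f S ∂(Measure.pi fun _ : Fin n => ENNReal.ofReal (1 - α) • G + ENNReal.ofReal α • D) ≤
      (n * ENNReal.ofReal α) / (k + 1 : ℕ) +
      (a * ∫⁻ S, f S ∂(Measure.pi fun _ : Fin n => G) + b) := by
  have hone : ENNReal.ofReal (1 - α) + ENNReal.ofReal α = 1 := by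
    rw [← ENNReal.ofReal_add (by linarith) h0]; simp
  let γ : Measure (X × X) := ENNReal.ofReal (1 - α) • G.map (fun x => (x, x)) +
    ENNReal.ofReal α • G.prod D
  have hdm : Measurable (fun x : X => (x, x)) := by fun_prop
  have : IsProbabilityMeasure (G.map (fun x => (x, x))) :=
    Measure.isProbabilityMeasure_map hdm.aemeasurable
  have hγ : IsProbabilityMeasure γ := ⟨by simp [γ, hone]⟩
  have hfst : γ.map Prod.fst = G := by
    simp only [γ]
    rw [Measure.map_add _ _ measurable_fst, Measure.map_smul, Measure.map_smul,
      Measure.map_map measurable_fst hdm]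
    simp only [Function.comp_def, Measure.map_id', Measure.map_fst_prod, measure_univ, one_smul]
    rw [← add_smul, hone, one_smul]
  have hsnd : γ.map Prod.snd = ENNReal.ofReal (1 - α) • G + ENNReal.ofReal α • D := by
    simp only [γ]
    rw [Measure.map_add _ _ measurable_snd, Measure.map_smul, Measure.map_smul,
      Measure.map_map measurable_snd hdm]
    simp only [Function.comp_def, Measure.map_id', Measure.map_snd_prod, measure_univ, one_smul]
  have hE : MeasurableSet {z : X × X | z.1 ≠ z.2} :=
    (measurableSet_eq_fun measurable_fst measurable_snd).compl
  have hne : γ {z | z.1 ≠ z.2} ≤ ENNReal.ofReal α := by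
    simp only [γ, Measure.add_apply, Measure.smul_apply, smul_eq_mul]
    rw [Measure.map_apply hdm hE]
    simp only [Set.preimage_ofPred_eq, ne_eq, not_true_eq_false, Set.ofPred_false, measure_empty,
      mul_zero, zero_add]
    exact (mul_le_mul_right prob_le_one _).trans (by simp)
  have hfst' : (Measure.pi fun _ : Fin n => γ).map (fun z i => (z i).1) =
      Measure.pi fun _ : Fin n => G := by
    have : ∀ i : Fin n, SigmaFinite (γ.map Prod.fst) := fun _ => by rw [hfst]; infer_instance
    rw [Measure.pi_map_pi (f := fun _ => Prod.fst) (fun _ => measurable_fst.aemeasurable)]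
    simp only [hfst]
  have : IsProbabilityMeasure (γ.map Prod.snd) :=
    Measure.isProbabilityMeasure_map measurable_snd.aemeasurable
  have hsnd' : (Measure.pi fun _ : Fin n => γ).map (fun z i => (z i).2) =
      Measure.pi fun _ : Fin n => ENNReal.ofReal (1 - α) • G + ENNReal.ofReal α • D := by
    rw [Measure.pi_map_pi (f := fun _ => Prod.snd) (fun _ => measurable_snd.aemeasurable)]
    simp only [hsnd]
  rw [← hsnd', ← hfst', lintegral_map hf (by fun_prop), lintegral_map hf (by fun_prop)]
  let K : (Fin n → X × X) → ℝ≥0∞ := fun z => ∑ i : Fin n,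
    Set.indicator {z : X × X | z.1 ≠ z.2} 1 (z i)
  have hKm : Measurable K := by
    refine Finset.measurable_sum _ fun i _ => ?_
    exact (measurable_one.indicator hE).comp (measurable_pi_apply i)
  have hK : ∫⁻ z, K z ∂(Measure.pi fun _ : Fin n => γ) ≤ n * ENNReal.ofReal α := by
    simp only [K]
    have hm : ∀ i ∈ (Finset.univ : Finset (Fin n)), Measurable fun z : Fin n → X × X =>
        Set.indicator {z : X × X | z.1 ≠ z.2} (1 : X × X → ℝ≥0∞) (z i) :=
      fun i _ => (measurable_one.indicator hE).comp (measurable_pi_apply i)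
    rw [lintegral_finsetSum _ hm]
    have : ∀ i : Fin n, ∫⁻ z, Set.indicator {z : X × X | z.1 ≠ z.2} (1 : X × X → ℝ≥0∞) (z i)
        ∂(Measure.pi fun _ : Fin n => γ) ≤ ENNReal.ofReal α := by
      intro i
      rw [(measurePreserving_eval (fun _ : Fin n => γ) i).lintegral_comp
        (measurable_one.indicator hE), lintegral_indicator_one hE]
      exact hne
    exact (Finset.sum_le_sum fun i _ => this i).trans (by simp)
  have hKcard : ∀ z, K z = ((Finset.univ.filter fun i => (z i).2 ≠ (z i).1).card : ℝ≥0∞) := by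
    intro z
    simp only [K, Set.indicator_apply, Set.mem_ofPred_eq, Pi.one_apply]
    rw [Finset.sum_boole]
    simp only [ne_comm]
  have hpt : ∀ z : Fin n → X × X, f (fun i => (z i).2) ≤
      K z / (k + 1 : ℕ) + (a * f (fun i => (z i).1) + b) := by
    intro z
    by_cases hc : (Finset.univ.filter fun i => (z i).2 ≠ (z i).1).card ≤ k
    · exact (hab _ _ hc).trans le_add_self
    · refine (hf1 _).trans (le_trans ?_ le_self_add)
      rw [hKcard, ENNReal.le_div_iff_mul_le (by simp) (by simp), one_mul]
      exact Nat.cast_le.2 (Nat.lt_of_not_le hc)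
  calc _ ≤ ∫⁻ z, (K z / (k + 1 : ℕ) + (a * f (fun i => (z i).1) + b))
        ∂(Measure.pi fun _ : Fin n => γ) := lintegral_mono hpt
    _ = (∫⁻ z, K z ∂(Measure.pi fun _ : Fin n => γ)) / (k + 1 : ℕ) +
      (a * ∫⁻ z, f (fun i => (z i).1) ∂(Measure.pi fun _ : Fin n => γ) + b) := by
        have hfm : Measurable fun z : Fin n → X × X => f (fun i => (z i).1) :=
          hf.comp (by fun_prop)
        rw [lintegral_add_left (hKm.div_const _), lintegral_add_left (hfm.const_mul _),
          lintegral_const_mul _ hfm]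
        simp only [div_eq_mul_inv]
        rw [lintegral_mul_const _ hKm]
        simp
    _ ≤ _ := by gcongr

lemma cone_vol {d : ℕ} (w : Vec d) (hw : ‖w‖ = 1) :
    volume {x : Vec d | (x ∈ Metric.ball (0 : Vec d) 1 \ {0}) ∧ sinU w (‖x‖⁻¹ • x) < 1 / 1000} ≤
      ENNReal.ofReal (2001 * (2 / 1000) ^ d) * volume (Metric.ball (0 : Vec d) 1) := by
  have hsub : {x : Vec d | (x ∈ Metric.ball (0 : Vec d) 1 \ {0}) ∧
      sinU w (‖x‖⁻¹ • x) < 1 / 1000} ⊆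
      ⋃ j ∈ Finset.Icc (-1000 : ℤ) 1000, Metric.ball (((j : ℝ) / 1000) • w) (2 / 1000) := by
    rintro x ⟨⟨hx1, hx0⟩, hs⟩
    have hx1 : ‖x‖ < 1 := by simpa using hx1
    have hx0 : 0 < ‖x‖ := norm_pos_iff.2 (by simpa using hx0)
    unfold sinU iprod at hs
    rw [Real.sqrt_lt' (by norm_num), real_inner_smul_right] at hs
    set t : ℝ := inner ℝ w x with ht
    have htx : |t| ≤ ‖x‖ := by
      have := abs_real_inner_le_norm w x
      rwa [hw, one_mul] at this
    have hnsq : ‖x - t • w‖ ^ 2 = ‖x‖ ^ 2 - t ^ 2 := by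
      rw [norm_sub_sq_real, norm_smul, real_inner_smul_right, real_inner_comm, ← ht, hw]
      simp; ring
    have h2 : ‖x‖ ^ 2 - t ^ 2 < (1 / 1000) ^ 2 * ‖x‖ ^ 2 := by
      have : ‖x‖ ^ 2 - t ^ 2 = (1 - (‖x‖⁻¹ * t) ^ 2) * ‖x‖ ^ 2 := by field_simp
      rw [this]
      exact mul_lt_mul_of_pos_right hs (by positivity)
    have h3 : ‖x - t • w‖ < 1 / 1000 := by
      refine lt_of_pow_lt_pow_left₀ 2 (by norm_num) ?_
      rw [hnsq]; nlinarith
    have hr := abs_sub_round (1000 * t)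
    rw [abs_le] at hr htx
    simp only [Set.mem_iUnion, Finset.mem_Icc, Metric.mem_ball, exists_prop]
    refine ⟨round (1000 * t), ⟨?_, ?_⟩, ?_⟩
    · by_contra hc
      have : round (1000 * t) ≤ -1001 := by omega
      have : (round (1000 * t) : ℝ) ≤ -1001 := by exact_mod_cast this
      linarith
    · by_contra hc
      have : 1001 ≤ round (1000 * t) := by omega
      have : (1001 : ℝ) ≤ round (1000 * t) := by exact_mod_cast this
      linarith
    · rw [dist_eq_norm]
      have e : x - ((round (1000 * t) : ℝ) / 1000) • w =
          (x - t • w) + (t - (round (1000 * t) : ℝ) / 1000) • w := by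
        rw [sub_smul]; abel
      rw [e]
      have h4 : |t - (round (1000 * t) : ℝ) / 1000| ≤ 1 / 2000 := by
        rw [abs_le]; constructor <;> linarith
      calc _ ≤ ‖x - t • w‖ + ‖(t - (round (1000 * t) : ℝ) / 1000) • w‖ := norm_add_le _ _
        _ = ‖x - t • w‖ + |t - (round (1000 * t) : ℝ) / 1000| := by
          rw [norm_smul, hw, mul_one, Real.norm_eq_abs]
        _ < _ := by linarith
  refine (measure_mono hsub).trans ((measure_biUnion_finset_le _ _).trans ?_)
  rw [Finset.sum_congr rfl fun j _ => Measure.addHaar_ball_of_pos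
    (volume : Measure (Vec d)) _ (show (0 : ℝ) < 2 / 1000 by norm_num)]
  rw [Finset.sum_const, ENNReal.ofReal_mul (by norm_num), finrank_euclideanSpace_fin]
  simp [mul_assoc]

lemma sinU_comm {d : ℕ} (u v : Vec d) : sinU u v = sinU v u := by
  simp [sinU, iprod, real_inner_comm]

lemma exists_dir {d : ℕ} (hd : 2 ≤ d) (μ : Measure (Metric.sphere (0 : Vec d) 1))
    [IsProbabilityMeasure μ] :
    ∃ v : Vec d, ‖v‖ = 1 ∧ μ {w | sinU (w : Vec d) v < 1 / 1000} ≤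
      ENNReal.ofReal (2001 * (2 / 1000) ^ d) := by
  have : Nonempty (Fin d) := ⟨⟨0, by omega⟩⟩
  have : Nontrivial (Vec d) := inferInstance
  set s : Set (Vec d) := Metric.ball (0 : Vec d) 1 \ {0} with hsdef
  have hsm : MeasurableSet s := measurableSet_ball.diff (measurableSet_singleton _)
  have hvol : volume s = volume (Metric.ball (0 : Vec d) 1) := by
    rw [hsdef]; exact measure_sdiff_null (measure_singleton _)
  have hpos : volume s ≠ 0 := by
    rw [hvol]; exact (Metric.measure_ball_pos volume _ one_pos).ne'
  have hfin : volume s ≠ ⊤ := by rw [hvol]; exact measure_ball_lt_top.ne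
  have hTm : MeasurableSet {z : Vec d × Metric.sphere (0 : Vec d) 1 |
      sinU (z.2 : Vec d) (‖z.1‖⁻¹ • z.1) < 1 / 1000} := by
    refine measurableSet_lt ?_ measurable_const
    unfold sinU iprod
    fun_prop
  have hm : Measurable fun x : Vec d =>
      μ {w | sinU (w : Vec d) (‖x‖⁻¹ • x) < 1 / 1000} :=
    measurable_measure_prodMk_left hTm
  obtain ⟨x, hx, hle⟩ := exists_le_setLAverage (μ := volume) hpos hfin hm.aemeasurable
  refine ⟨‖x‖⁻¹ • x, ?_, hle.trans ?_⟩
  · have : ‖x‖ ≠ 0 := by simpa using hx.2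
    rw [norm_smul]; simp [this]
  · rw [setLAverage_eq]
    refine ENNReal.div_le_of_le_mul ?_
    have e1 : ∫⁻ x in s, μ {w | sinU (w : Vec d) (‖x‖⁻¹ • x) < 1 / 1000} =
        ((volume.restrict s).prod μ) {z : Vec d × Metric.sphere (0 : Vec d) 1 |
          sinU (z.2 : Vec d) (‖z.1‖⁻¹ • z.1) < 1 / 1000} := by
      rw [Measure.prod_apply hTm]; rfl
    rw [e1, Measure.prod_apply_symm hTm]
    have hb : ∀ w : Metric.sphere (0 : Vec d) 1, (volume.restrict s)
        ((fun x => (x, w)) ⁻¹' {z : Vec d × Metric.sphere (0 : Vec d) 1 |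
          sinU (z.2 : Vec d) (‖z.1‖⁻¹ • z.1) < 1 / 1000}) ≤
        ENNReal.ofReal (2001 * (2 / 1000) ^ d) * volume s := by
      intro w
      rw [Measure.restrict_apply' hsm, hvol]
      refine le_trans (measure_mono ?_) (cone_vol (w : Vec d) (by simp))
      rintro x ⟨h1, h2⟩
      exact ⟨h2, h1⟩
    refine (lintegral_mono hb).trans ?_
    simp

lemma stdE_eq (d : ℕ) : stdGaussianE d = stdGaussian (Vec d) := by
  rw [← map_pi_eq_stdGaussian]; rfl

instance stdE_prob (d : ℕ) : IsProbabilityMeasure (stdGaussianE d) := by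
  rw [stdE_eq]; infer_instance

lemma stdE_integrable {d : ℕ} (f : Vec d → ℝ) (hf : Continuous f) (a b : ℝ)
    (h : ∀ x, |f x| ≤ a + b * ‖x‖ ^ 4) : Integrable f (stdGaussianE d) := by
  rw [stdE_eq]
  have h4 : Integrable (fun x : Vec d => ‖x‖ ^ 4) (stdGaussian (Vec d)) :=
    (IsGaussian.memLp_id (stdGaussian (Vec d)) 4 (by simp)).integrable_norm_pow (by norm_num)
  refine Integrable.mono' ((integrable_const a).add (h4.const_mul b)) hf.aestronglyMeasurable ?_
  exact Filter.Eventually.of_forall h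

lemma stdE_map {d : ℕ} (u : Vec d) (hu : ‖u‖ = 1) :
    (stdGaussianE d).map (fun x => inner ℝ u x) = gaussianReal 0 1 := by
  rw [stdE_eq]
  have := IsGaussian.map_eq_gaussianReal (μ := stdGaussian (Vec d)) (innerSL ℝ u)
  rw [variance_dual_stdGaussian, integral_strongDual_stdGaussian] at this
  simpa [hu] using this

lemma stdE_four {d : ℕ} (u : Vec d) (hu : ‖u‖ = 1) :
    ∫ x, (inner ℝ u x) ^ 4 ∂(stdGaussianE d) = ∫ t, t ^ 4 ∂(gaussianReal 0 1) := by
  rw [← stdE_map u hu, integral_map (by fun_prop) (by fun_prop)]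

lemma stdE_mean (d : ℕ) : ∫ x, x ∂(stdGaussianE d) = 0 := by
  rw [stdE_eq]; exact integral_id_stdGaussian

lemma stdE_cov (d : ℕ) (i j : Fin d) :
    ∫ x, x i * x j ∂(stdGaussianE d) = (1 : Mat d) i j := by
  have h := covariance_eval_multivariateGaussian (μ := (0 : Vec d)) (S := (1 : Mat d))
    Matrix.PosSemidef.one i j
  rw [multivariateGaussian_zero_one, ← stdE_eq] at h
  have hm : ∀ i : Fin d, MemLp (fun x : Vec d => x i) 2 (stdGaussianE d) := by
    intro i
    refine (memLp_two_iff_integrable_sq (by fun_prop)).2 ?_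
    refine stdE_integrable _ (by fun_prop) 1 1 fun x => ?_
    have : |x i| ≤ ‖x‖ := PiLp.norm_apply_le x i
    have h2 : |x i| ^ 2 ≤ ‖x‖ ^ 2 := by gcongr
    rw [abs_pow]
    nlinarith [sq_nonneg (‖x‖ ^ 2 - 1)]
  have h0 : ∀ i : Fin d, ∫ x : Vec d, x i ∂(stdGaussianE d) = 0 := by
    intro i
    have := integral_strongDual_stdGaussian (EuclideanSpace.proj (𝕜 := ℝ) i : Vec d →L[ℝ] ℝ)
    rw [← stdE_eq] at this
    simpa using this
  rw [covariance_eq_sub (hm i) (hm j), h0] at h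
  simpa using h

/-- The hard mixture. -/
noncomputable def mixP (d : ℕ) (α : ℝ) (v : Vec d) : Measure (Vec d) :=
  ENNReal.ofReal (1 - α) • stdGaussianE d +
    ENNReal.ofReal (α / 2) • Measure.dirac ((α ^ (-(1 : ℝ) / 4)) • v) +
    ENNReal.ofReal (α / 2) • Measure.dirac (-((α ^ (-(1 : ℝ) / 4)) • v))

lemma mix_integral {d : ℕ} {E : Type*} [NormedAddCommGroup E] [NormedSpace ℝ E] [CompleteSpace E]
    {α : ℝ} (h0 : 0 < α) (h1 : α ≤ 1) (v : Vec d) (f : Vec d → E)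
    (hf : Integrable f (stdGaussianE d)) :
    Integrable f (mixP d α v) ∧ ∫ x, f x ∂(mixP d α v) = (1 - α) • ∫ x, f x ∂(stdGaussianE d) +
      (α / 2) • f ((α ^ (-(1 : ℝ) / 4)) • v) + (α / 2) • f (-((α ^ (-(1 : ℝ) / 4)) • v)) := by
  have i1 : Integrable f (ENNReal.ofReal (1 - α) • stdGaussianE d) :=
    hf.smul_measure ENNReal.ofReal_ne_top
  have i2 : ∀ y : Vec d, Integrable f (ENNReal.ofReal (α / 2) • Measure.dirac y) := fun y =>
    (integrable_dirac (by simp)).smul_measure ENNReal.ofReal_ne_top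
  refine ⟨(i1.add_measure (i2 _)).add_measure (i2 _), ?_⟩
  unfold mixP
  rw [integral_add_measure (i1.add_measure (i2 _)) (i2 _), integral_add_measure i1 (i2 _)]
  simp only [integral_smul_measure, integral_dirac]
  rw [ENNReal.toReal_ofReal (by linarith), ENNReal.toReal_ofReal (by linarith)]

lemma mix_mean {d : ℕ} {α : ℝ} (h0 : 0 < α) (h1 : α ≤ 1) (v : Vec d) :
    ∫ x, x ∂(mixP d α v) = 0 := by
  rw [(mix_integral h0 h1 v (fun x => x) (by
    rw [stdE_eq]; exact IsGaussian.integrable_id)).2, stdE_mean]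
  simp

lemma alpha_sq {α : ℝ} (h0 : 0 < α) : α * (α ^ (-(1 : ℝ) / 4)) ^ 2 = √α := by
  rw [← Real.rpow_natCast, ← Real.rpow_mul h0.le, Real.sqrt_eq_rpow]
  nth_rewrite 1 [← Real.rpow_one α]
  rw [← Real.rpow_add h0]; norm_num

lemma alpha_four {α : ℝ} (h0 : 0 < α) : α * (α ^ (-(1 : ℝ) / 4)) ^ 4 = 1 := by
  rw [← Real.rpow_natCast, ← Real.rpow_mul h0.le]
  nth_rewrite 1 [← Real.rpow_one α]
  rw [← Real.rpow_add h0]; norm_num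

lemma mix_cov {d : ℕ} {α : ℝ} (h0 : 0 < α) (h1 : α ≤ 1) (v : Vec d) :
    covMatrix (mixP d α v) = (1 - α) • (1 : Mat d) + Real.sqrt α • outer v v := by
  ext i j
  simp only [covMatrix, toVec', Matrix.of_apply]
  rw [(mix_integral h0 h1 v (fun x => x i * x j) ?_).2, stdE_cov, ← alpha_sq h0]
  · simp [outer, toVec', Matrix.vecMulVec_apply]
    ring
  · refine stdE_integrable _ (by fun_prop) 1 1 fun x => ?_
    have a1 : |x i| ≤ ‖x‖ := PiLp.norm_apply_le x i
    have a2 : |x j| ≤ ‖x‖ := PiLp.norm_apply_le x j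
    have : |x i| * |x j| ≤ ‖x‖ * ‖x‖ := by gcongr
    rw [abs_mul]
    nlinarith [sq_nonneg (‖x‖ ^ 2 - 1)]

lemma mix_four {d : ℕ} {α : ℝ} (h0 : 0 < α) (h1 : α ≤ 1) (v : Vec d) (hv : ‖v‖ = 1)
    (u : Vec d) (hu : ‖u‖ = 1) :
    Integrable (fun x => (inner ℝ u x) ^ 4) (mixP d α v) ∧
    ∫ x, (inner ℝ u x) ^ 4 ∂(mixP d α v) ≤ (∫ t, t ^ 4 ∂(gaussianReal 0 1)) + 1 := by
  have := mix_integral h0 h1 v (fun x => (inner ℝ u x) ^ 4) ?_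
  · refine ⟨this.1, ?_⟩
    rw [this.2, stdE_four u hu]
    have hp : 0 ≤ ∫ t, t ^ 4 ∂(gaussianReal 0 1) := integral_nonneg fun t => by positivity
    have hi : (inner ℝ u v) ^ 4 ≤ 1 := by
      have := abs_real_inner_le_norm u v
      rw [hu, hv, one_mul] at this
      have h2 : |inner ℝ u v| ^ 4 ≤ 1 := pow_le_one₀ (abs_nonneg _) this
      rwa [Even.pow_abs (by decide)] at h2
    simp only [inner_neg_right, real_inner_smul_right, smul_eq_mul]
    have e : (1 - α) * (∫ t, t ^ 4 ∂(gaussianReal 0 1)) +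
        α / 2 * (α ^ (-(1 : ℝ) / 4) * inner ℝ u v) ^ 4 +
        α / 2 * (-(α ^ (-(1 : ℝ) / 4) * inner ℝ u v)) ^ 4 =
        (1 - α) * (∫ t, t ^ 4 ∂(gaussianReal 0 1)) +
        (α * (α ^ (-(1 : ℝ) / 4)) ^ 4) * (inner ℝ u v) ^ 4 := by ring
    rw [e, alpha_four h0]
    nlinarith
  · refine stdE_integrable _ (by fun_prop) 0 1 fun x => ?_
    have := abs_real_inner_le_norm u x
    rw [hu, one_mul] at this
    rw [abs_pow, zero_add, one_mul]
    gcongr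

lemma specNorm_le {d : ℕ} (A : Mat d) (c : ℝ) (hc : 0 ≤ c)
    (h : ∀ y z : Vec d, ‖y‖ = 1 → ‖z‖ = 1 → ∑ i, ∑ j, y i * z j * A i j ≤ c) :
    specNorm A ≤ c := by
  unfold specNorm
  refine ContinuousLinearMap.opNorm_le_of_unit_norm hc fun z hz => ?_
  set w : Vec d := Matrix.toEuclideanCLM (𝕜 := ℝ) A z with hw
  by_cases h0 : ‖w‖ = 0
  · rw [h0]; exact hc
  · have := h (‖w‖⁻¹ • w) z (by rw [norm_smul]; simp [h0]) hz
    have hwi : ∀ i, w i = ∑ j, A i j * z j := by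
      intro i; rw [hw]; rfl
    have e : ∑ i, ∑ j, (‖w‖⁻¹ • w) i * z j * A i j = ‖w‖ := by
      have : ∀ i, ∑ j, (‖w‖⁻¹ • w) i * z j * A i j = ‖w‖⁻¹ * (w i) ^ 2 := by
        intro i
        have e1 : ∀ j, (‖w‖⁻¹ • w) i * z j * A i j = ‖w‖⁻¹ * w i * (A i j * z j) := by
          intro j; simp; ring
        simp_rw [e1]
        rw [← Finset.mul_sum, ← hwi]; ring
      simp_rw [this]
      rw [← Finset.mul_sum, ← EuclideanSpace.real_norm_sq_eq]
      field_simp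
    rwa [e] at this

lemma entry_eq {d : ℕ} (X : Mat d) (u : Vec d) (i j : Fin d) :
    (X * outer u u * Xᵀ) i j = (∑ k, X i k * u k) * (∑ k, X j k * u k) := by
  simp only [Matrix.mul_apply, outer, toVec', Matrix.vecMulVec_apply, Matrix.transpose_apply]
  rw [Finset.sum_mul_sum, Finset.sum_comm]
  refine Finset.sum_congr rfl fun k _ => ?_
  rw [Finset.sum_mul]
  refine Finset.sum_congr rfl fun l _ => ?_
  ring

lemma row_eq {d : ℕ} (α : ℝ) (v u x : Vec d) (i : Fin d) :
    ∑ k, (outer x x - ((1 - α) • (1 : Mat d) + √α • outer v v)) i k * u k =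
      x i * inner ℝ u x - ((1 - α) * u i + √α * (v i * inner ℝ u v)) := by
  simp only [outer, toVec', Matrix.sub_apply, Matrix.add_apply, Matrix.smul_apply,
    Matrix.vecMulVec_apply, smul_eq_mul, sub_mul, add_mul, Finset.sum_sub_distrib,
    Finset.sum_add_distrib, PiLp.inner_apply, RCLike.inner_apply, conj_trivial, Finset.mul_sum]
  congr 1
  · exact Finset.sum_congr rfl fun k _ => by ring
  · congr 1
    · simp [Matrix.one_apply]
    · exact Finset.sum_congr rfl fun k _ => by ring

lemma row_memLp {d : ℕ} {α : ℝ} (h0 : 0 < α) (h1 : α ≤ 1) (v : Vec d)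
    (u : Vec d) (hu : ‖u‖ = 1) (i : Fin d) (c : ℝ) :
    MemLp (fun x : Vec d => x i * inner ℝ u x - c) 2 (mixP d α v) := by
  refine (memLp_two_iff_integrable_sq (Continuous.aestronglyMeasurable (by fun_prop))).2 ?_
  refine (mix_integral h0 h1 v _ ?_).1
  refine stdE_integrable _ (by fun_prop) (2 * c ^ 2) 2 fun x => ?_
  have a1 : |x i| ≤ ‖x‖ := PiLp.norm_apply_le x i
  have a2 := abs_real_inner_le_norm u x
  rw [hu, one_mul] at a2
  have h3 : |x i * inner ℝ u x| ≤ ‖x‖ ^ 2 := by rw [abs_mul, sq]; gcongr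
  have h4 : (x i * inner ℝ u x) ^ 2 ≤ (‖x‖ ^ 2) ^ 2 := by
    rw [← sq_abs]; gcongr
  rw [abs_of_nonneg (sq_nonneg _)]
  nlinarith [sq_nonneg (x i * inner ℝ u x + c)]

/-- The moment constant. -/
noncomputable def momC : ℝ := 2 * ((∫ t, t ^ 4 ∂(gaussianReal 0 1)) + 1) + 8

lemma momC_pos : 0 < momC := by
  have hp : 0 ≤ ∫ t, t ^ 4 ∂(gaussianReal 0 1) := integral_nonneg fun t => by positivity
  unfold momC; linarith

lemma quad_bound {d : ℕ} {α : ℝ} (h0 : 0 < α) (h1 : α ≤ 1) (v : Vec d) (hv : ‖v‖ = 1)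
    (u : Vec d) (hu : ‖u‖ = 1) (y : Vec d) (hy : ‖y‖ = 1) :
    ∫ x, (∑ i, y i * (x i * inner ℝ u x - ((1 - α) * u i + √α * (v i * inner ℝ u v)))) ^ 2
      ∂(mixP d α v) ≤ momC := by
  obtain ⟨i1, b1⟩ := mix_four h0 h1 v hv u hu
  obtain ⟨i2, b2⟩ := mix_four h0 h1 v hv y hy
  have : IsFiniteMeasure (mixP d α v) := by
    have h := (mix_integral h0 h1 v (fun _ => (1 : ℝ)) (integrable_const _)).1
    exact (integrable_const_iff_isFiniteMeasure one_ne_zero).1 h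
  have hprob : (mixP d α v).real Set.univ = 1 := by
    have := (mix_integral h0 h1 v (fun _ => (1 : ℝ)) (integrable_const _)).2
    simp at this
    rw [this]; ring
  have hpt : ∀ x : Vec d,
      (∑ i, y i * (x i * inner ℝ u x - ((1 - α) * u i + √α * (v i * inner ℝ u v)))) ^ 2 ≤
      (inner ℝ u x) ^ 4 + (inner ℝ y x) ^ 4 + 8 := by
    intro x
    have e : ∑ i, y i * (x i * inner ℝ u x - ((1 - α) * u i + √α * (v i * inner ℝ u v))) =
        inner ℝ y x * inner ℝ u x - ((1 - α) * inner ℝ y u + √α * (inner ℝ y v * inner ℝ u v)) := by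
      have : ∀ i, y i * (x i * inner ℝ u x - ((1 - α) * u i + √α * (v i * inner ℝ u v))) =
        (x i * y i) * inner ℝ u x - ((1 - α) * (u i * y i) + √α * ((v i * y i) * inner ℝ u v)) := by
        intro i; ring
      simp_rw [this]
      rw [Finset.sum_sub_distrib, Finset.sum_add_distrib, ← Finset.sum_mul, ← Finset.mul_sum,
        ← Finset.mul_sum, ← Finset.sum_mul]
      simp only [PiLp.inner_apply, RCLike.inner_apply, conj_trivial]
    rw [e]
    have c1 := abs_real_inner_le_norm y u
    have c2 := abs_real_inner_le_norm y v
    have c3 := abs_real_inner_le_norm u v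
    rw [hy, hu, one_mul] at c1
    rw [hy, hv, one_mul] at c2
    rw [hu, hv, one_mul] at c3
    have hs : √α ≤ 1 := Real.sqrt_le_one.2 h1
    have hB : |(1 - α) * inner ℝ y u + √α * (inner ℝ y v * inner ℝ u v)| ≤ 2 := by
      calc _ ≤ |(1 - α) * inner ℝ y u| + |√α * (inner ℝ y v * inner ℝ u v)| := abs_add_le _ _
        _ = (1 - α) * |inner ℝ y u| + √α * (|inner ℝ y v| * |inner ℝ u v|) := by
          rw [abs_mul, abs_mul, abs_mul, abs_of_nonneg (by linarith : 0 ≤ 1 - α),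
            abs_of_nonneg (Real.sqrt_nonneg α)]
        _ ≤ 1 * 1 + 1 * (1 * 1) := by
          gcongr
          linarith
        _ = 2 := by norm_num
    set B := (1 - α) * inner ℝ y u + √α * (inner ℝ y v * inner ℝ u v)
    have hB2 : B ^ 2 ≤ 4 := by
      rw [← sq_abs]; nlinarith [abs_nonneg B]
    nlinarith [sq_nonneg (inner ℝ y x * inner ℝ u x + B),
      sq_nonneg ((inner ℝ y x) ^ 2 - (inner ℝ u x) ^ 2)]
  calc _ ≤ ∫ x, ((inner ℝ u x) ^ 4 + (inner ℝ y x) ^ 4 + 8) ∂(mixP d α v) := by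
        refine integral_mono_of_nonneg (Filter.Eventually.of_forall fun x => sq_nonneg _)
          ((i1.add i2).add (integrable_const _)) (Filter.Eventually.of_forall hpt)
    _ = (∫ x, (inner ℝ u x) ^ 4 ∂(mixP d α v)) + (∫ x, (inner ℝ y x) ^ 4 ∂(mixP d α v)) + 8 := by
        have i3 : Integrable (fun x => (inner ℝ u x) ^ 4 + (inner ℝ y x) ^ 4) (mixP d α v) :=
          i1.add i2
        rw [integral_add i3 (integrable_const _), integral_add i1 i2]
        simp [hprob]
    _ ≤ momC := by unfold momC; linarith

lemma mom2 {d : ℕ} {α : ℝ} (h0 : 0 < α) (h1 : α ≤ 1) (v : Vec d) (hv : ‖v‖ = 1)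
    (u : Vec d) (hu : ‖u‖ = 1) :
    (∀ i j, Integrable (fun x => ((outer x x - ((1 - α) • (1 : Mat d) + √α • outer v v)) * outer u u
      * (outer x x - ((1 - α) • (1 : Mat d) + √α • outer v v))ᵀ) i j) (mixP d α v)) ∧
    specNorm (matExp (mixP d α v) fun x =>
      (outer x x - ((1 - α) • (1 : Mat d) + √α • outer v v)) * outer u u
      * (outer x x - ((1 - α) • (1 : Mat d) + √α • outer v v))ᵀ) ≤ momC := by
  let r : Fin d → Vec d → ℝ := fun i x =>
    x i * inner ℝ u x - ((1 - α) * u i + √α * (v i * inner ℝ u v))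
  have hr : ∀ i, MemLp (r i) 2 (mixP d α v) := fun i => row_memLp h0 h1 v u hu i _
  have hI : ∀ i j, Integrable (fun x => r i x * r j x) (mixP d α v) :=
    fun i j => (hr i).integrable_mul (hr j)
  have hent : ∀ (x : Vec d) i j, ((outer x x - ((1 - α) • (1 : Mat d) + √α • outer v v)) * outer u u
      * (outer x x - ((1 - α) • (1 : Mat d) + √α • outer v v))ᵀ) i j = r i x * r j x := by
    intro x i j
    rw [entry_eq, row_eq, row_eq]
  refine ⟨fun i j => by simp_rw [hent]; exact hI i j, ?_⟩
  refine specNorm_le _ _ momC_pos.le fun y z hy hz => ?_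
  simp only [matExp, Matrix.of_apply, hent]
  have hL : ∀ y : Vec d, MemLp (fun x => ∑ i, y i * r i x) 2 (mixP d α v) := fun y =>
    memLp_finsetSum _ fun i _ => (hr i).const_mul _
  have e : ∑ i, ∑ j, y i * z j * ∫ x, r i x * r j x ∂(mixP d α v) =
      ∫ x, (∑ i, y i * r i x) * (∑ j, z j * r j x) ∂(mixP d α v) := by
    have : ∀ x, (∑ i, y i * r i x) * (∑ j, z j * r j x) =
        ∑ i, ∑ j, y i * z j * (r i x * r j x) := by
      intro x
      rw [Finset.sum_mul_sum]
      exact Finset.sum_congr rfl fun i _ => Finset.sum_congr rfl fun j _ => by ring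
    simp_rw [this]
    rw [integral_finsetSum _ fun i _ => integrable_finsetSum _ fun j _ => (hI i j).const_mul _]
    refine Finset.sum_congr rfl fun i _ => ?_
    rw [integral_finsetSum _ fun j _ => (hI i j).const_mul _]
    exact Finset.sum_congr rfl fun j _ => (integral_const_mul _ _).symm
  rw [e]
  have q1 := quad_bound h0 h1 v hv u hu y hy
  have q2 := quad_bound h0 h1 v hv u hu z hz
  have s1 := (hL y).integrable_sq
  have s2 := (hL z).integrable_sq
  calc _ ≤ ∫ x, ((1 / 2) * (∑ i, y i * r i x) ^ 2 + (1 / 2) * (∑ j, z j * r j x) ^ 2)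
        ∂(mixP d α v) := by
        refine integral_mono ((hL y).integrable_mul (hL z))
          ((s1.const_mul _).add (s2.const_mul _)) fun x => ?_
        simp only
        nlinarith [sq_nonneg ((∑ i, y i * r i x) - (∑ j, z j * r j x))]
    _ ≤ momC := by
        rw [integral_add (s1.const_mul _) (s2.const_mul _), integral_const_mul, integral_const_mul]
        linarith

lemma specNorm_sum_le {d : ℕ} {ι : Type*} (s : Finset ι) (A : ι → Mat d) :
    specNorm (∑ k ∈ s, A k) ≤ ∑ k ∈ s, specNorm (A k) := by
  unfold specNorm
  rw [map_sum]
  exact norm_sum_le _ _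

lemma mom1 {d : ℕ} {α : ℝ} (h0 : 0 < α) (h1 : α ≤ 1) (v : Vec d) (hv : ‖v‖ = 1) :
    specNorm (matExp (mixP d α v) fun x =>
      (outer x x - ((1 - α) • (1 : Mat d) + √α • outer v v))
      * (outer x x - ((1 - α) • (1 : Mat d) + √α • outer v v))ᵀ) ≤ momC * d := by
  have hb : ∀ k : Fin d, ‖(EuclideanSpace.single k (1 : ℝ) : Vec d)‖ = 1 := by simp
  have hX : ∀ (X : Mat d) (i j : Fin d), (X * Xᵀ) i j = ∑ k : Fin d,
      (X * outer (EuclideanSpace.single k (1 : ℝ) : Vec d) (EuclideanSpace.single k (1 : ℝ)) * Xᵀ)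
        i j := by
    intro X i j
    simp_rw [entry_eq]
    simp [Matrix.mul_apply]
  have e : (matExp (mixP d α v) fun x =>
      (outer x x - ((1 - α) • (1 : Mat d) + √α • outer v v))
      * (outer x x - ((1 - α) • (1 : Mat d) + √α • outer v v))ᵀ) =
      ∑ k : Fin d, matExp (mixP d α v) fun x =>
      (outer x x - ((1 - α) • (1 : Mat d) + √α • outer v v)) *
        outer (EuclideanSpace.single k (1 : ℝ) : Vec d) (EuclideanSpace.single k (1 : ℝ))
      * (outer x x - ((1 - α) • (1 : Mat d) + √α • outer v v))ᵀ := by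
    ext i j
    rw [Matrix.sum_apply]
    simp only [matExp, Matrix.of_apply]
    simp_rw [hX]
    exact integral_finsetSum _ fun k _ => (mom2 h0 h1 v hv _ (hb k)).1 i j
  rw [e]
  refine (specNorm_sum_le _ _).trans ?_
  refine (Finset.sum_le_sum fun k _ => (mom2 h0 h1 v hv _ (hb k)).2).trans ?_
  simp [mul_comm]

lemma mulVecE_SP {d : ℕ} (α : ℝ) (v u : Vec d) :
    mulVecE ((1 - α) • (1 : Mat d) + √α • outer v v) u = (1 - α) • u + (√α * iprod u v) • v := by
  ext i
  have e : mulVecE ((1 - α) • (1 : Mat d) + √α • outer v v) u i =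
      ∑ k, ((1 - α) • (1 : Mat d) + √α • outer v v) i k * u k := rfl
  rw [e]
  have := row_eq α v u 0 i
  simp only [Matrix.sub_apply, sub_mul, Finset.sum_sub_distrib] at this
  have z : ∑ k, outer (0 : Vec d) 0 i k * u k = 0 := by
    simp [outer, toVec', Matrix.vecMulVec_apply]
  rw [z] at this
  simp only [PiLp.zero_apply, zero_mul, zero_sub, neg_inj] at this
  rw [this]
  simp [iprod]; ring

lemma mixP_eq {d : ℕ} {α : ℝ} (h0 : 0 < α) (v : Vec d) :
    mixP d α v = ENNReal.ofReal (1 - α) • stdGaussianE d + ENNReal.ofReal α •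
      (ENNReal.ofReal (1 / 2) • Measure.dirac ((α ^ (-(1 : ℝ) / 4)) • v) +
        ENNReal.ofReal (1 / 2) • Measure.dirac (-((α ^ (-(1 : ℝ) / 4)) • v))) := by
  unfold mixP
  rw [smul_add, smul_smul, smul_smul, ← ENNReal.ofReal_mul h0.le, ← add_assoc]
  congr 4 <;> ring_nf

lemma half_prob {d : ℕ} (x y : Vec d) : IsProbabilityMeasure
    (ENNReal.ofReal (1 / 2) • Measure.dirac x + ENNReal.ofReal (1 / 2) • Measure.dirac y) := by
  refine ⟨?_⟩
  simp only [Measure.add_apply, Measure.smul_apply, measure_univ, smul_eq_mul, mul_one]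
  rw [← ENNReal.ofReal_add (by norm_num) (by norm_num)]; norm_num

lemma mixP_prob {d : ℕ} {α : ℝ} (h0 : 0 < α) (h1 : α ≤ 1) (v : Vec d) :
    IsProbabilityMeasure (mixP d α v) := by
  rw [mixP_eq h0]
  have := half_prob ((α ^ (-(1 : ℝ) / 4)) • v) (-((α ^ (-(1 : ℝ) / 4)) • v))
  refine ⟨?_⟩
  rw [Measure.add_apply, Measure.smul_apply, Measure.smul_apply, measure_univ, measure_univ]
  simp only [smul_eq_mul, mul_one]
  rw [← ENNReal.ofReal_add (by linarith) h0.le]; simp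

lemma risk {d n : ℕ} {ε δ : ℝ} (hd : 2 ≤ d) (hn : 1 ≤ n) (hε : 0 < ε) (hεd : ε ≤ (d : ℝ) / 4)
    (hδ : 0 < δ) (hδ' : δ ≤ (1 - Real.exp (-ε)) / (8 * Real.exp ε))
    (M : Kernel (Fin n → Vec d) (Metric.sphere (0 : Vec d) 1)) [IsMarkovKernel M]
    (hM : DiffPrivate M ε δ) (m : ℝ) (hmd : m ≤ d) (hm0 : 0 < m)
    (hmL : m ≤ Real.log ((1 - Real.exp (-ε)) / δ)) (α : ℝ) (h0 : 0 < α) (h1 : α ≤ 1)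
    (hα : n * α ≤ m / (16 * ε)) :
    ∃ v : Vec d, ‖v‖ = 1 ∧ ENNReal.ofReal (1 / 4000) ≤
      ∫⁻ S, (∫⁻ vh, ENNReal.ofReal (sinU (vh : Vec d) v) ∂(M S))
                 ∂(Measure.pi fun _ : Fin n => mixP d α v) := by
  obtain ⟨v, hv, hvA⟩ := exists_dir hd ((Measure.pi fun _ : Fin n => stdGaussianE d).bind M)
  refine ⟨v, hv, ?_⟩
  have := mixP_prob h0 h1 v
  have hexp : Real.exp (-ε) < 1 := by rw [Real.exp_lt_one_iff]; linarith
  have h1e : 0 < 1 - Real.exp (-ε) := by linarith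
  set A : Set (Metric.sphere (0 : Vec d) 1) := {w | sinU (w : Vec d) v < 1 / 1000} with hA
  have hsm : Measurable fun w : Metric.sphere (0 : Vec d) 1 => sinU (w : Vec d) v := by
    unfold sinU iprod
    fun_prop
  have hAm : MeasurableSet A := measurableSet_lt hsm measurable_const
  rw [Measure.bind_apply hAm M.measurable.aemeasurable] at hvA
  set q : ℕ := ⌊m / (2 * ε)⌋₊ with hq
  have hq1 : (q : ℝ) ≤ m / (2 * ε) := Nat.floor_le (by positivity)
  have hq2 : m / (2 * ε) < q + 1 := Nat.lt_floor_add_one _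
  have hqε : q * ε ≤ m / 2 := by
    calc q * ε ≤ m / (2 * ε) * ε := by gcongr
      _ = m / 2 := by field_simp
  have := half_prob ((α ^ (-(1 : ℝ) / 4)) • v) (-((α ^ (-(1 : ℝ) / 4)) • v))
  have hc := coupling (n := n) (stdGaussianE d) (ENNReal.ofReal (1 / 2) •
      Measure.dirac ((α ^ (-(1 : ℝ) / 4)) • v) +
        ENNReal.ofReal (1 / 2) • Measure.dirac (-((α ^ (-(1 : ℝ) / 4)) • v))) α h0.le h1
      (fun S => M S A) (M.measurable_coe hAm) (fun S => prob_le_one)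
      (ENNReal.ofReal (Real.exp ((q + 1 : ℕ) * ε)))
      (ENNReal.ofReal (δ * ∑ j ∈ Finset.range (q + 1), Real.exp (j * ε))) (q + 1) (by
        intro S S' hS
        have := group_priv M hε hδ hM A hAm (q + 1) S S' (by convert hS)
        have hsum : 0 ≤ δ * ∑ j ∈ Finset.range (q + 1), Real.exp (j * ε) := by positivity
        rw [← ofReal_measureReal, ← ofReal_measureReal (μ := M S'),
          ← ENNReal.ofReal_mul (by positivity), ← ENNReal.ofReal_add (by positivity) hsum]
        exact ENNReal.ofReal_le_ofReal this)
  rw [← mixP_eq h0] at hc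
  -- the three terms
  have t1 : (n * ENNReal.ofReal α) / ((q + 1 + 1 : ℕ) : ℝ≥0∞) ≤ ENNReal.ofReal (1 / 8) := by
    refine ENNReal.div_le_of_le_mul ?_
    rw [← ENNReal.ofReal_natCast, ← ENNReal.ofReal_natCast, ← ENNReal.ofReal_mul (by positivity),
      ← ENNReal.ofReal_mul (by positivity)]
    refine ENNReal.ofReal_le_ofReal (hα.trans ?_)
    have : m / (16 * ε) = 1 / 8 * (m / (2 * ε)) := by field_simp; norm_num
    rw [this]; push_cast
    gcongr
    linarith
  have t2 : ENNReal.ofReal (Real.exp ((q + 1 : ℕ) * ε)) *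
      ∫⁻ S, M S A ∂(Measure.pi fun _ : Fin n => stdGaussianE d) ≤ ENNReal.ofReal (1 / 8) := by
    refine (mul_le_mul_right hvA _).trans ?_
    rw [← ENNReal.ofReal_mul (by positivity)]
    refine ENNReal.ofReal_le_ofReal ?_
    have e1 : Real.exp ((q + 1 : ℕ) * ε) ≤ 3 ^ d := by
      calc Real.exp ((q + 1 : ℕ) * ε) ≤ Real.exp (d * 1) := by
            refine Real.exp_le_exp.2 ?_
            push_cast; nlinarith
        _ = Real.exp 1 ^ d := by rw [← Real.exp_nat_mul]
        _ ≤ 3 ^ d := by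
            gcongr
            exact Real.exp_one_lt_three.le
    have e2 : (3 : ℝ) ^ d * (2 / 1000) ^ d ≤ (6 / 1000) ^ 2 := by
      rw [← mul_pow, show (3 : ℝ) * (2 / 1000) = 6 / 1000 by norm_num]
      exact pow_le_pow_of_le_one (by norm_num) (by norm_num) hd
    have e3 : (0 : ℝ) ≤ (2 / 1000) ^ d := by positivity
    nlinarith [mul_le_mul_of_nonneg_right e1 e3]
  have t3 : ENNReal.ofReal (δ * ∑ j ∈ Finset.range (q + 1), Real.exp (j * ε)) ≤
      ENNReal.ofReal (1 / 2) := by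
    refine ENNReal.ofReal_le_ofReal ?_
    set L := Real.log ((1 - Real.exp (-ε)) / δ) with hL
    have eL : Real.exp L = (1 - Real.exp (-ε)) / δ := Real.exp_log (by positivity)
    have hL8 : 8 ≤ Real.exp L := by
      rw [eL, le_div_iff₀ hδ]
      rw [le_div_iff₀ (by positivity)] at hδ'
      have := Real.one_le_exp hε.le
      nlinarith
    have eh : Real.exp L = Real.exp (L / 2) * Real.exp (L / 2) := by
      rw [← Real.exp_add]; congr 1; ring
    have h2 : 2 ≤ Real.exp (L / 2) := by
      have := Real.exp_pos (L / 2)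
      nlinarith
    have hg := geom_bound (ε := ε) q
    have hqL : Real.exp (q * ε) ≤ Real.exp (L / 2) := Real.exp_le_exp.2 (by linarith)
    have hδe : δ = (1 - Real.exp (-ε)) / Real.exp L := by
      rw [eL]; field_simp
    rw [hδe, div_mul_eq_mul_div, div_le_iff₀ (Real.exp_pos _), mul_comm (1 - _)]
    refine hg.trans (hqL.trans ?_)
    rw [eh]; nlinarith
  have hμA : ((Measure.pi fun _ : Fin n => mixP d α v).bind M) A ≤ ENNReal.ofReal (3 / 4) := by
    rw [Measure.bind_apply hAm M.measurable.aemeasurable]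
    refine hc.trans ((add_le_add t1 (add_le_add t2 t3)).trans ?_)
    rw [← ENNReal.ofReal_add (by norm_num) (by norm_num),
      ← ENNReal.ofReal_add (by norm_num) (by norm_num)]
    exact ENNReal.ofReal_le_ofReal (by norm_num)
  have hμc : ENNReal.ofReal (1 / 4) ≤ ((Measure.pi fun _ : Fin n => mixP d α v).bind M) Aᶜ := by
    rw [prob_compl_eq_one_sub hAm]
    calc ENNReal.ofReal (1 / 4) = 1 - ENNReal.ofReal (3 / 4) := by
          rw [← ENNReal.ofReal_one, ← ENNReal.ofReal_sub _ (by norm_num)]; norm_num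
      _ ≤ _ := by gcongr
  have hsm' : Measurable fun w : Metric.sphere (0 : Vec d) 1 =>
      ENNReal.ofReal (sinU (w : Vec d) v) := hsm.ennreal_ofReal
  rw [← Measure.lintegral_bind M.measurable.aemeasurable hsm'.aemeasurable]
  have hmk := mul_meas_ge_le_lintegral (μ := (Measure.pi fun _ : Fin n => mixP d α v).bind M)
    hsm' (ENNReal.ofReal (1 / 1000))
  refine le_trans ?_ hmk
  calc ENNReal.ofReal (1 / 4000) = ENNReal.ofReal (1 / 1000) * ENNReal.ofReal (1 / 4) := by
        rw [← ENNReal.ofReal_mul (by norm_num)]; norm_num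
    _ ≤ ENNReal.ofReal (1 / 1000) * ((Measure.pi fun _ : Fin n => mixP d α v).bind M) Aᶜ := by
        gcongr
    _ ≤ _ := by
        gcongr
        intro w hw
        simp only [hA, Set.mem_compl_iff, Set.mem_ofPred_eq, not_lt] at hw
        exact ENNReal.ofReal_le_ofReal hw

/-- Theorem 5.4: lower bound without the sub-Gaussian tail assumption,
approximate DP, with the hard instances made explicit. -/
theorem statement_5 :
    ∃ C : ℝ, 0 < C ∧
      ∀ (d n : ℕ) (ε δ : ℝ), 2 ≤ d → 1 ≤ n → 0 < ε → ε ≤ (d : ℝ) / 4 →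
        0 < δ → δ ≤ (1 - Real.exp (-ε)) / (8 * Real.exp ε) →
        ∀ (M : Kernel (Fin n → Vec d) (Metric.sphere (0 : Vec d) 1)) [IsMarkovKernel M],
          DiffPrivate M ε δ →
          ∃ v : Vec d, ‖v‖ = 1 ∧ ∃ α : ℝ, α ∈ Set.Ioc (0 : ℝ) 1 ∧
            (let P : Measure (Vec d) :=
               ENNReal.ofReal (1 - α) • stdGaussianE d +
                 ENNReal.ofReal (α / 2) • Measure.dirac ((α ^ (-(1 : ℝ) / 4)) • v) +
                 ENNReal.ofReal (α / 2) • Measure.dirac (-((α ^ (-(1 : ℝ) / 4)) • v))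
             let SP : Mat d := (1 - α) • (1 : Mat d) + Real.sqrt α • outer v v
             let κP : ℝ := (1 - α + Real.sqrt α) / Real.sqrt α
             -- P has mean zero and covariance Σ_P
             (∫ x, x ∂P) = 0 ∧
             covMatrix P = SP ∧
             -- spectral structure of Σ_P
             mulVecE SP v = (1 - α + Real.sqrt α) • v ∧
             (∀ u : Vec d, ‖u‖ = 1 → iprod u v = 0 → mulVecE SP u = (1 - α) • u) ∧
             (1 - α + Real.sqrt α) / ((1 - α + Real.sqrt α) - (1 - α)) = κP ∧
             -- moment bounds
             specNorm (matExp P fun x => (outer x x - SP) * (outer x x - SP)ᵀ) ≤ C * d ∧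
             (∀ u : Vec d, ‖u‖ = 1 →
               specNorm (matExp P fun x =>
                 (outer x x - SP) * outer u u * (outer x x - SP)ᵀ) ≤ C) ∧
             -- the risk lower bound
             ENNReal.ofReal ((1 / C) * κP *
                 min (Real.sqrt (min (d : ℝ)
                   (Real.log ((1 - Real.exp (-ε)) / δ)) / (ε * n))) 1) ≤
               ∫⁻ S, (∫⁻ vh, ENNReal.ofReal (sinU (vh : Vec d) v) ∂(M S))
                 ∂(Measure.pi fun _ : Fin n => P)) := by
  refine ⟨32000 + momC, by linarith [momC_pos], ?_⟩
  intro d n ε δ hd hn hε hεd hδ hδ' M _ hM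
  have hC := momC_pos
  have hd' : (2 : ℝ) ≤ d := by exact_mod_cast hd
  have hn' : (1 : ℝ) ≤ n := by exact_mod_cast hn
  have hexp : Real.exp (-ε) < 1 := by rw [Real.exp_lt_one_iff]; linarith
  have hLpos : 0 < Real.log ((1 - Real.exp (-ε)) / δ) := by
    refine Real.log_pos ?_
    rw [lt_div_iff₀ hδ]
    rw [le_div_iff₀ (by positivity)] at hδ'
    have := Real.one_le_exp hε.le
    nlinarith
  set m : ℝ := min (d : ℝ) (Real.log ((1 - Real.exp (-ε)) / δ)) with hm
  have hm0 : 0 < m := lt_min (by linarith) hLpos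
  have hεn : 0 < ε * n := by positivity
  set α : ℝ := min (m / (16 * (ε * n))) 1 with hαdef
  have h0 : 0 < α := lt_min (by positivity) one_pos
  have h1 : α ≤ 1 := min_le_right _ _
  have hα : n * α ≤ m / (16 * ε) := by
    calc n * α ≤ n * (m / (16 * (ε * n))) := by gcongr; exact min_le_left _ _
      _ = m / (16 * ε) := by field_simp
  obtain ⟨v, hv, hrisk⟩ := risk hd hn hε hεd hδ hδ' M hM m (min_le_left _ _) hm0
    (min_le_right _ _) α h0 h1 hα
  refine ⟨v, hv, α, ⟨h0, h1⟩, ?_⟩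
  have hvv : iprod v v = 1 := by simp [iprod, hv]
  have hs0 : 0 < √α := Real.sqrt_pos.2 h0
  refine ⟨mix_mean h0 h1 v, mix_cov h0 h1 v, ?_, ?_, ?_, ?_, ?_, ?_⟩
  · rw [mulVecE_SP, hvv, mul_one, ← add_smul]
  · intro u _ huv
    rw [mulVecE_SP, huv]; simp
  · congr 1; ring
  · refine (mom1 h0 h1 v hv).trans ?_
    gcongr
    linarith
  · intro u hu
    exact (mom2 h0 h1 v hv u hu).2.trans (by linarith)
  · refine le_trans (ENNReal.ofReal_le_ofReal ?_) hrisk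
    have hs1 : √α ≤ 1 := Real.sqrt_le_one.2 h1
    have hκ : (1 - α + √α) / √α * min (√(m / (ε * n))) 1 ≤ 8 := by
      rw [div_mul_eq_mul_div, div_le_iff₀ hs0]
      have hmin : min (√(m / (ε * n))) 1 ≤ 4 * √α := by
        rcases le_total (m / (16 * (ε * n))) 1 with h | h
        · have ha : α = m / (16 * (ε * n)) := min_eq_left h
          have e : m / (ε * n) = 4 ^ 2 * α := by rw [ha]; field_simp; norm_num
          refine (min_le_left _ _).trans ?_
          rw [e, Real.sqrt_mul (by norm_num), Real.sqrt_sq (by norm_num)]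
        · have ha : α = 1 := min_eq_right h
          refine (min_le_right _ _).trans ?_
          rw [ha]; norm_num
      have hmin0 : 0 ≤ min (√(m / (ε * n))) 1 := le_min (Real.sqrt_nonneg _) zero_le_one
      nlinarith
    have hinv : 1 / (32000 + momC) ≤ 1 / 32000 := by
      gcongr
      linarith
    have hnn : 0 ≤ (1 - α + √α) / √α * min (√(m / (ε * n))) 1 := by
      have : 0 ≤ 1 - α + √α := by linarith
      have hmin0 : 0 ≤ min (√(m / (ε * n))) 1 := le_min (Real.sqrt_nonneg _) zero_le_one
      positivity
    calc 1 / (32000 + momC) * ((1 - α + √α) / √α) * min (√(m / (ε * n))) 1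
        = 1 / (32000 + momC) * ((1 - α + √α) / √α * min (√(m / (ε * n))) 1) := by ring
      _ ≤ 1 / 32000 * 8 := by gcongr
      _ = 1 / 4000 := by norm_num
end

section
/- There exists a universal constant C > 0 such that for every d ≥ 1, every unit vector v ∈ ℝ^d, and every α ∈ (0,1], the distribution P_v := (1−α)·N(0, I_d) + α·( ½δ_{α^{−1/4}v} + ½δ_{−α^{−1/4}v} ), with covariance Σ_v = (1−α)·I_d + √α·vvᵀ, satisfies for x ∼ P_v: ‖E[(xxᵀ−Σ_v)(xxᵀ−Σ_v)ᵀ]‖₂ ≤ C·d, and for every unit vector u ∈ ℝ^d, ‖E[(xxᵀ−Σ_v)uuᵀ(xxᵀ−Σ_v)ᵀ]‖₂ ≤ C. -/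
open MeasureTheory ProbabilityTheory Real Matrix
open scoped ENNReal NNReal Classical

lemma MB_map_gauss {d : ℕ} : stdGaussianE d = stdGaussian (Vec d) := by
  rw [← map_pi_eq_stdGaussian]; rfl

lemma MB_fourth {d : ℕ} (w : Vec d) (hw : ‖w‖ = 1) :
    ∫ x, (inner ℝ w x) ^ 4 ∂(stdGaussianE d) = ∫ t, t ^ 4 ∂(gaussianReal 0 1) := by
  rw [MB_map_gauss]
  have h := IsGaussian.map_eq_gaussianReal (μ := stdGaussian (Vec d)) (innerSL ℝ w)
  rw [integral_strongDual_stdGaussian, variance_dual_stdGaussian, innerSL_apply_norm, hw] at h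
  have h1 : ((1:ℝ) ^ 2).toNNReal = 1 := by simp
  rw [h1] at h
  rw [← h, integral_map (by fun_prop) (by fun_prop)]
  simp

lemma MB_memLp {d : ℕ} : MemLp id 4 (stdGaussianE d) := by
  rw [MB_map_gauss]
  exact IsGaussian.memLp_id _ 4 (by norm_num)

instance {d : ℕ} : IsProbabilityMeasure (stdGaussianE d) := by
  rw [MB_map_gauss]; infer_instance

lemma MB_lin {d : ℕ} {P : Measure (Vec d)} (hP : MemLp id 4 P) (w : Vec d) :
    MemLp (fun x => (inner ℝ w x : ℝ)) 4 P :=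
  (innerSL ℝ w).comp_memLp' hP

lemma MB_quad {d : ℕ} {P : Measure (Vec d)} [IsFiniteMeasure P] (hP : MemLp id 4 P) (w u : Vec d)
    (c : ℝ) : MemLp (fun x => (inner ℝ w x : ℝ) * inner ℝ u x - c) 2 P := by
  haveI : ENNReal.HolderTriple 4 4 2 := ⟨by
    rw [show (4 : ℝ≥0∞) = 2 * 2 by norm_num, ENNReal.mul_inv (by simp) (by simp), ← mul_add,
      ENNReal.inv_two_add_inv_two, mul_one]⟩
  exact (MemLp.mul' (MB_lin hP u) (MB_lin hP w)).sub (memLp_const c)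

lemma MB_int4 {d : ℕ} {P : Measure (Vec d)} [IsFiniteMeasure P] (hP : MemLp id 4 P) (w : Vec d) :
    Integrable (fun x => (inner ℝ w x : ℝ) ^ 4) P := by
  have h := (MB_quad hP w w 0).integrable_mul (MB_quad hP w w 0)
  refine h.congr (Filter.Eventually.of_forall fun x => ?_)
  simp; ring

/-- the random vector `(x xᵀ - S) u` -/
def MB_vec {d : ℕ} (S : Mat d) (u x : Vec d) : Fin d → ℝ :=
  (outer x x - S) *ᵥ u.ofLp

lemma MB_vec_dot {d : ℕ} (S : Mat d) (u x w : Vec d) :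
    w.ofLp ⬝ᵥ MB_vec S u x = (inner ℝ w x : ℝ) * inner ℝ u x - w.ofLp ⬝ᵥ S *ᵥ u.ofLp := by
  unfold MB_vec outer toVec'
  rw [Matrix.sub_mulVec, Matrix.vecMulVec_mulVec, dotProduct_sub]
  simp only [EuclideanSpace.inner_eq_star_dotProduct, star_trivial, op_smul_eq_smul,
    dotProduct_smul, smul_eq_mul]
  rw [dotProduct_comm x.ofLp w.ofLp]
  ring

lemma MB_memVec {d : ℕ} {P : Measure (Vec d)} [IsFiniteMeasure P] (hP : MemLp id 4 P)
    (S : Mat d) (u w : Vec d) : MemLp (fun x => w.ofLp ⬝ᵥ MB_vec S u x) 2 P := by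
  simp_rw [MB_vec_dot]
  exact MB_quad hP w u _

lemma MB_memVec_i {d : ℕ} {P : Measure (Vec d)} [IsFiniteMeasure P] (hP : MemLp id 4 P)
    (S : Mat d) (u : Vec d) (i : Fin d) : MemLp (fun x => MB_vec S u x i) 2 P := by
  simpa using MB_memVec hP S u (EuclideanSpace.single i 1)

lemma MB_entry {d : ℕ} (S : Mat d) (u x : Vec d) (i j : Fin d) :
    ((outer x x - S) * outer u u * (outer x x - S)ᵀ) i j = MB_vec S u x i * MB_vec S u x j := by
  unfold MB_vec
  conv_lhs => rw [show outer u u = Matrix.vecMulVec u.ofLp u.ofLp from rfl]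
  rw [Matrix.mul_vecMulVec, Matrix.vecMulVec_mul, Matrix.vecMul_transpose, Matrix.vecMulVec_apply]

lemma MB_form {d : ℕ} {P : Measure (Vec d)} [IsFiniteMeasure P] (hP : MemLp id 4 P)
    (S : Mat d) (u w z : Vec d) :
    w.ofLp ⬝ᵥ (matExp P fun x => (outer x x - S) * outer u u * (outer x x - S)ᵀ) *ᵥ z.ofLp
      = ∫ x, (w.ofLp ⬝ᵥ MB_vec S u x) * (z.ofLp ⬝ᵥ MB_vec S u x) ∂P := by
  have hI : ∀ i j, Integrable (fun x => MB_vec S u x i * MB_vec S u x j) P := fun i j =>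
    (MB_memVec_i hP S u i).integrable_mul (MB_memVec_i hP S u j)
  have e : ∀ x, (w.ofLp ⬝ᵥ MB_vec S u x) * (z.ofLp ⬝ᵥ MB_vec S u x)
      = ∑ i, ∑ j, (w i * z j) * (MB_vec S u x i * MB_vec S u x j) := by
    intro x
    simp only [dotProduct, Finset.sum_mul_sum]
    refine Finset.sum_congr rfl fun i _ => Finset.sum_congr rfl fun j _ => by ring
  simp_rw [e]
  rw [integral_finsetSum _ fun i _ => integrable_finsetSum _ fun j _ => (hI i j).const_mul _]
  simp_rw [dotProduct, Matrix.mulVec, dotProduct, matExp, Matrix.of_apply, MB_entry, Finset.mul_sum]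
  refine Finset.sum_congr rfl fun i _ => ?_
  rw [integral_finsetSum _ fun j _ => (hI i j).const_mul _]
  refine Finset.sum_congr rfl fun j _ => ?_
  rw [integral_const_mul]; ring

lemma MB_second {d : ℕ} {P : Measure (Vec d)} [IsProbabilityMeasure P] (hP : MemLp id 4 P)
    (S : Mat d) (M : ℝ) (hM : ∀ w : Vec d, ‖w‖ = 1 → ∫ x, (inner ℝ w x : ℝ) ^ 4 ∂P ≤ M)
    (hS : ∀ w u : Vec d, ‖w‖ = 1 → ‖u‖ = 1 → |w.ofLp ⬝ᵥ S *ᵥ u.ofLp| ≤ 2)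
    (u w : Vec d) (hu : ‖u‖ = 1) (hw : ‖w‖ = 1) :
    ∫ x, (w.ofLp ⬝ᵥ MB_vec S u x) ^ 2 ∂P ≤ 2 * M + 8 := by
  have hle : ∀ x, (w.ofLp ⬝ᵥ MB_vec S u x) ^ 2 ≤
      (inner ℝ w x : ℝ) ^ 4 + (inner ℝ u x : ℝ) ^ 4 + 8 := by
    intro x
    rw [MB_vec_dot]
    have h := sq_le_sq' (abs_le.1 (hS w u hw hu)).1 (abs_le.1 (hS w u hw hu)).2
    generalize (inner ℝ w x : ℝ) = a at *
    generalize (inner ℝ u x : ℝ) = b at *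
    generalize w.ofLp ⬝ᵥ S *ᵥ u.ofLp = c at *
    nlinarith [sq_nonneg (a * b + c), sq_nonneg (a ^ 2 - b ^ 2)]
  have hi := (MB_int4 hP w).add (MB_int4 hP u)
  calc _ ≤ ∫ x, ((inner ℝ w x : ℝ) ^ 4 + (inner ℝ u x : ℝ) ^ 4 + 8) ∂P :=
        integral_mono (MB_memVec hP S u w).integrable_sq (hi.add (integrable_const 8)) hle
    _ = ∫ x, (inner ℝ w x : ℝ) ^ 4 ∂P + ∫ x, (inner ℝ u x : ℝ) ^ 4 ∂P + 8 := by
        rw [integral_add (f := fun x => (inner ℝ w x : ℝ) ^ 4 + (inner ℝ u x : ℝ) ^ 4) hi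
          (integrable_const 8), integral_add (MB_int4 hP w) (MB_int4 hP u)]
        simp
    _ ≤ _ := by linarith [hM w hw, hM u hu]

lemma MB_H {d : ℕ} {P : Measure (Vec d)} [IsProbabilityMeasure P] (hP : MemLp id 4 P)
    (S : Mat d) (M : ℝ) (hM0 : 0 ≤ M)
    (hM : ∀ w : Vec d, ‖w‖ = 1 → ∫ x, (inner ℝ w x : ℝ) ^ 4 ∂P ≤ M)
    (hS : ∀ w u : Vec d, ‖w‖ = 1 → ‖u‖ = 1 → |w.ofLp ⬝ᵥ S *ᵥ u.ofLp| ≤ 2)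
    (u : Vec d) (hu : ‖u‖ = 1) :
    specNorm (matExp P fun x => (outer x x - S) * outer u u * (outer x x - S)ᵀ) ≤ 2 * M + 8 := by
  refine ContinuousLinearMap.opNorm_le_of_re_inner_le (𝕜 := ℝ) (by positivity) fun z w hz hw => ?_
  rw [real_inner_comm, Matrix.inner_toEuclideanCLM, MB_form hP]
  have h1 := MB_second hP S M hM hS u w hu hw
  have h2 := MB_second hP S M hM hS u z hu hz
  have i1 := (MB_memVec hP S u w).integrable_sq
  have i2 := (MB_memVec hP S u z).integrable_sq
  have := integral_mono ((MB_memVec hP S u w).integrable_mul (MB_memVec hP S u z))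
    ((i1.add i2).div_const 2) (fun x => by
      simp only [Pi.mul_apply, Pi.add_apply]
      nlinarith [sq_nonneg (w.ofLp ⬝ᵥ MB_vec S u x - z.ofLp ⬝ᵥ MB_vec S u x)])
  rw [integral_div] at this
  simp only [Pi.mul_apply, Pi.add_apply] at this
  rw [integral_add i1 i2] at this
  simp only [RCLike.re_to_real]
  linarith

lemma MB_total {d : ℕ} {P : Measure (Vec d)} [IsProbabilityMeasure P] (hP : MemLp id 4 P)
    (S : Mat d) (M : ℝ) (hM0 : 0 ≤ M)
    (hM : ∀ w : Vec d, ‖w‖ = 1 → ∫ x, (inner ℝ w x : ℝ) ^ 4 ∂P ≤ M)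
    (hS : ∀ w u : Vec d, ‖w‖ = 1 → ‖u‖ = 1 → |w.ofLp ⬝ᵥ S *ᵥ u.ofLp| ≤ 2) :
    specNorm (matExp P fun x => (outer x x - S) * (outer x x - S)ᵀ) ≤ (2 * M + 8) * d := by
  have e : (matExp P fun x => (outer x x - S) * (outer x x - S)ᵀ) =
      ∑ k : Fin d, matExp P fun x => (outer x x - S) *
        outer (EuclideanSpace.single k 1) (EuclideanSpace.single k 1) * (outer x x - S)ᵀ := by
    ext i j
    rw [Matrix.sum_apply]
    simp only [matExp, Matrix.of_apply, MB_entry]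
    have hI : ∀ k : Fin d, Integrable (fun x => MB_vec S (EuclideanSpace.single k 1) x i *
        MB_vec S (EuclideanSpace.single k 1) x j) P := fun k =>
      (MB_memVec_i hP S _ i).integrable_mul (MB_memVec_i hP S _ j)
    rw [← integral_finsetSum _ fun k _ => hI k]
    congr 1
    ext x
    simp [MB_vec, Matrix.mul_apply]
  rw [e]
  unfold specNorm
  rw [map_sum]
  refine (norm_sum_le _ _).trans ?_
  refine (Finset.sum_le_sum fun k _ => MB_H hP S M hM0 hM hS (EuclideanSpace.single k 1)
    (by simp)).trans ?_
  simp only [Finset.sum_const, Finset.card_univ, Fintype.card_fin, nsmul_eq_mul]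
  rw [mul_comm]

/-- moment bounds (V = O(d), γ = O(1)) for the hard-instance mixture
of Theorem 5.4 (Appendix C.2). -/
theorem statement_14 :
    ∃ C : ℝ, 0 < C ∧
      ∀ (d : ℕ) (v : Vec d) (α : ℝ), 1 ≤ d → ‖v‖ = 1 → α ∈ Set.Ioc (0 : ℝ) 1 →
        (let P : Measure (Vec d) :=
           ENNReal.ofReal (1 - α) • stdGaussianE d +
             ENNReal.ofReal (α / 2) • Measure.dirac ((α ^ (-(1 : ℝ) / 4)) • v) +
             ENNReal.ofReal (α / 2) • Measure.dirac (-((α ^ (-(1 : ℝ) / 4)) • v))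
         let SP : Mat d := (1 - α) • (1 : Mat d) + Real.sqrt α • outer v v
         specNorm (matExp P fun x => (outer x x - SP) * (outer x x - SP)ᵀ) ≤ C * d ∧
           ∀ u : Vec d, ‖u‖ = 1 →
             specNorm (matExp P fun x =>
               (outer x x - SP) * outer u u * (outer x x - SP)ᵀ) ≤ C) := by
  refine ⟨2 * (∫ t, t ^ 4 ∂(gaussianReal 0 1) + 1) + 8, ?_, ?_⟩
  · have : 0 ≤ ∫ t, t ^ 4 ∂(gaussianReal 0 1) := integral_nonneg fun t => by positivity
    positivity
  intro d v α hd hv hα P SP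
  obtain ⟨hα0, hα1⟩ := hα
  have hK : 0 ≤ ∫ t, t ^ 4 ∂(gaussianReal 0 1) := integral_nonneg fun t => by positivity
  have hint : ∀ f : Vec d → ℝ, Integrable f (stdGaussianE d) → Integrable f P := by
    intro f hf
    refine Integrable.add_measure (Integrable.add_measure ?_ ?_) ?_
    · exact hf.smul_measure (by simp)
    · exact (integrable_dirac (by simp)).smul_measure (by simp)
    · exact (integrable_dirac (by simp)).smul_measure (by simp)
  haveI : IsProbabilityMeasure P := ⟨by
    simp only [P, Measure.add_apply, Measure.smul_apply, measure_univ, smul_eq_mul, mul_one]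
    rw [← ENNReal.ofReal_add (by linarith) (by linarith),
      ← ENNReal.ofReal_add (by linarith) (by linarith)]
    rw [show 1 - α + α / 2 + α / 2 = 1 by ring, ENNReal.ofReal_one]⟩
  have hP : MemLp id 4 P := by
    have h := hint _ ((integrable_norm_rpow_iff (by fun_prop) (by norm_num) (by norm_num)).2
      (MB_memLp (d := d)))
    exact (integrable_norm_rpow_iff (by fun_prop) (by norm_num) (by norm_num)).1 h
  have hin : ∀ a b : Vec d, ‖a‖ = 1 → ‖b‖ = 1 → |(inner ℝ a b : ℝ)| ≤ 1 := by
    intro a b ha hb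
    simpa [ha, hb] using abs_real_inner_le_norm a b
  have hM : ∀ w : Vec d, ‖w‖ = 1 →
      ∫ x, (inner ℝ w x : ℝ) ^ 4 ∂P ≤ ∫ t, t ^ 4 ∂(gaussianReal 0 1) + 1 := by
    intro w hw
    have hg : Integrable (fun x => (inner ℝ w x : ℝ) ^ 4) (stdGaussianE d) := MB_int4 MB_memLp w
    have hr : (α ^ (-(1 : ℝ) / 4)) ^ 4 = α⁻¹ := by
      rw [← Real.rpow_natCast, ← Real.rpow_mul hα0.le, ← Real.rpow_neg_one]
      norm_num
    have h4 : (inner ℝ w v : ℝ) ^ 4 ≤ 1 := by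
      rw [← Even.pow_abs (by decide)]
      exact pow_le_one₀ (abs_nonneg _) (hin w v hw hv)
    simp only [P]
    rw [integral_add_measure, integral_add_measure, integral_smul_measure, integral_smul_measure,
      integral_smul_measure, integral_dirac, integral_dirac, MB_fourth w hw]
    · rw [inner_neg_right, real_inner_smul_right, Even.neg_pow (by decide), mul_pow, hr,
        ENNReal.toReal_ofReal (by linarith), ENNReal.toReal_ofReal (by linarith)]
      simp only [smul_eq_mul]
      have : α / 2 * (α⁻¹ * (inner ℝ w v : ℝ) ^ 4) = (inner ℝ w v : ℝ) ^ 4 / 2 := by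
        field_simp
      rw [this]
      nlinarith
    · exact hg.smul_measure (by simp)
    · exact (integrable_dirac (by simp)).smul_measure (by simp)
    · exact (hg.smul_measure (by simp)).add_measure
        ((integrable_dirac (by simp)).smul_measure (by simp))
    · exact (integrable_dirac (by simp)).smul_measure (by simp)
  have hS : ∀ w u : Vec d, ‖w‖ = 1 → ‖u‖ = 1 → |w.ofLp ⬝ᵥ SP *ᵥ u.ofLp| ≤ 2 := by
    intro w u hw hu
    have e : w.ofLp ⬝ᵥ SP *ᵥ u.ofLp = (1 - α) * (inner ℝ w u : ℝ) +
        √α * ((inner ℝ w v : ℝ) * inner ℝ v u) := by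
      simp only [SP, outer, toVec', Matrix.add_mulVec, Matrix.smul_mulVec, Matrix.one_mulVec,
        Matrix.vecMulVec_mulVec, dotProduct_add, dotProduct_smul, op_smul_eq_smul, smul_eq_mul,
        EuclideanSpace.inner_eq_star_dotProduct, star_trivial]
      rw [dotProduct_comm u.ofLp w.ofLp, dotProduct_comm u.ofLp v.ofLp,
        dotProduct_comm v.ofLp w.ofLp]
      ring
    rw [e]
    have hs : √α ≤ 1 := Real.sqrt_le_one.2 hα1
    refine (abs_add_le _ _).trans ?_
    rw [abs_mul, abs_mul, abs_mul, abs_of_nonneg (Real.sqrt_nonneg α),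
      abs_of_nonneg (by linarith : 0 ≤ 1 - α)]
    have h1 : (1 - α) * |(inner ℝ w u : ℝ)| ≤ 1 :=
      mul_le_one₀ (by linarith) (abs_nonneg _) (hin w u hw hu)
    have h2 : √α * (|(inner ℝ w v : ℝ)| * |(inner ℝ v u : ℝ)|) ≤ 1 :=
      mul_le_one₀ hs (by positivity)
        (mul_le_one₀ (hin w v hw hv) (abs_nonneg _) (hin v u hv hu))
    linarith
  exact ⟨MB_total hP SP _ (by positivity) hM hS, fun u hu => MB_H hP SP _ (by positivity) hM hS u hu⟩
end
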